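/- arXiv:2007.09852 — 9 statements merged into one kernel-verified Lean document; each statement's English description precedes it below -/
import Mathlib

section
/- Let X be a measurable space and let P and Q be probability measures on X with P absolutely continuous with respect to Q. Then for every measurable function r : X → ℝ with r(x) > 0 for all x, and every integer m ≥ 2, the KL divergence satisfies D_KL(P ‖ Q) ≥ E[ log( m · r(x) / ( r(x) + Σ_{i=1}^{m-1} r(y_i) ) ) ], where the expectation is taken over x drawn from P and y_1, …, y_{m-1} drawn i.i.d. from Q, independently of x (i.e. with respect to the product measure P ⊗ Q^{m-1}). -/
open MeasureTheory Real
open scoped Classical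

/-- Kullback–Leibler divergence `∫ log (dP/dQ) dP`, valued in the extended reals:
it equals the integral of the log-likelihood ratio when `P ≪ Q` and that function
is `P`-integrable, and `⊤` otherwise. -/
noncomputable def klDiv {X : Type*} [MeasurableSpace X] (P Q : Measure X) : EReal :=
  if P ≪ Q ∧ Integrable (llr P Q) P then ((∫ x, llr P Q x ∂P : ℝ) : EReal) else ⊤

/-- The average of `|ι| * r (z i) / ∑ j, r (z j)` over i.i.d. coordinates is one. -/
lemma lintegral_pi_card_mul_div_sum {X ι : Type*} [MeasurableSpace X] [Fintype ι] [Nonempty ι]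
    (Q : Measure X) [IsProbabilityMeasure Q] {r : X → ℝ} (hr : Measurable r)
    (hrpos : ∀ x, 0 < r x) (i : ι) :
    ∫⁻ z : ι → X, ENNReal.ofReal (Fintype.card ι * r (z i) / ∑ j, r (z j))
      ∂(Measure.pi fun _ => Q) = 1 := by
  have hS : ∀ z : ι → X, 0 < ∑ j, r (z j) := fun z =>
    Finset.sum_pos (fun j _ => hrpos _) Finset.univ_nonempty
  have hmeas : ∀ k : ι, Measurable fun z : ι → X => ENNReal.ofReal (r (z k) / ∑ j, r (z j)) := by
    intro k
    fun_prop
  have hsymm : ∀ k : ι,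
      ∫⁻ z : ι → X, ENNReal.ofReal (r (z k) / ∑ j, r (z j)) ∂(Measure.pi fun _ => Q)
        = ∫⁻ z : ι → X, ENNReal.ofReal (r (z i) / ∑ j, r (z j)) ∂(Measure.pi fun _ => Q) := by
    intro k
    have hp := measurePreserving_piCongrLeft (fun _ : ι => Q) (Equiv.swap i k)
    rw [← hp.lintegral_comp (hmeas k)]
    refine lintegral_congr fun z => ?_
    have happ : ∀ j, MeasurableEquiv.piCongrLeft (fun _ : ι => X) (Equiv.swap i k) z j
        = z (Equiv.swap i k j) := by
      intro j
      conv_lhs => rw [← (Equiv.swap i k).apply_symm_apply j]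
      exact Equiv.piCongrLeft_apply_apply (fun _ : ι => X) (Equiv.swap i k) z _
    simp only [happ, Equiv.swap_apply_right]
    rw [Equiv.sum_comp (Equiv.swap i k) fun j => r (z j)]
  calc
    _ = ∫⁻ z : ι → X, Fintype.card ι * ENNReal.ofReal (r (z i) / ∑ j, r (z j))
          ∂(Measure.pi fun _ => Q) := by
      refine lintegral_congr fun z => ?_
      rw [mul_div_assoc, ENNReal.ofReal_mul (Nat.cast_nonneg _), ENNReal.ofReal_natCast]
    _ = ∑ k : ι, ∫⁻ z : ι → X, ENNReal.ofReal (r (z k) / ∑ j, r (z j))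
          ∂(Measure.pi fun _ => Q) := by
      rw [lintegral_const_mul _ (hmeas i), Finset.sum_congr rfl fun k _ => hsymm k]
      simp
    _ = ∫⁻ z : ι → X, 1 ∂(Measure.pi fun _ => Q) := by
      rw [← lintegral_finsetSum _ fun k _ => hmeas k]
      refine lintegral_congr fun z => ?_
      rw [← ENNReal.ofReal_sum_of_nonneg fun k _ => (div_pos (hrpos _) (hS z)).le,
        ← Finset.sum_div, div_self (hS z).ne', ENNReal.ofReal_one]
    _ = 1 := by simp

lemma lintegral_prod_pi_mul_div_add_sum {X : Type*} [MeasurableSpace X] (Q : Measure X)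
    [IsProbabilityMeasure Q] {r : X → ℝ} (hr : Measurable r) (hrpos : ∀ x, 0 < r x) (n : ℕ) :
    ∫⁻ p : X × (Fin n → X),
      ENNReal.ofReal (((n + 1 : ℕ) : ℝ) * r p.1 / (r p.1 + ∑ i : Fin n, r (p.2 i)))
      ∂(Q.prod (Measure.pi fun _ : Fin n => Q)) = 1 := by
  have hp := measurePreserving_piFinSuccAbove (fun _ : Fin (n + 1) => Q) 0
  rw [← lintegral_pi_card_mul_div_sum Q hr hrpos (0 : Fin (n + 1)),
    ← hp.lintegral_comp (by fun_prop)]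
  refine lintegral_congr fun z => ?_
  simp [Fin.sum_univ_succ, MeasurableEquiv.piFinSuccAbove, Fin.insertNthEquiv, Fin.tail]

lemma integral_nonpos_of_lintegral_exp_le_one {Ω : Type*} [MeasurableSpace Ω] {μ : Measure Ω}
    [IsProbabilityMeasure μ] {f : Ω → ℝ} (hf : Integrable f μ)
    (h : ∫⁻ ω, ENNReal.ofReal (exp (f ω)) ∂μ ≤ 1) : ∫ ω, f ω ∂μ ≤ 0 := by
  have hm : AEStronglyMeasurable (fun ω => exp (f ω)) μ :=
    continuous_exp.comp_aestronglyMeasurable hf.1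
  have hnn : 0 ≤ᵐ[μ] fun ω => exp (f ω) := ae_of_all _ fun ω => (exp_pos _).le
  have hint : Integrable (fun ω => exp (f ω)) μ :=
    (lintegral_ofReal_ne_top_iff_integrable hm hnn).1 (h.trans_lt ENNReal.one_lt_top).ne
  have hle : ∫ ω, exp (f ω) ∂μ ≤ 1 := by
    rw [integral_eq_lintegral_of_nonneg_ae hnn hm]
    exact ENNReal.toReal_le_of_le_ofReal zero_le_one (by simpa using h)
  calc
    ∫ ω, f ω ∂μ ≤ ∫ ω, (exp (f ω) - 1) ∂μ :=
      integral_mono hf (hint.sub (integrable_const 1)) fun ω => by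
        linarith [add_one_le_exp (f ω)]
    _ = ∫ ω, exp (f ω) ∂μ - 1 := by
      rw [integral_sub hint (integrable_const 1)]
      simp
    _ ≤ 0 := by linarith

lemma lintegral_exp_neg_llr_mul_le {X Y : Type*} [MeasurableSpace X] [MeasurableSpace Y]
    {P Q : Measure X} [SigmaFinite P] [SigmaFinite Q] (hPQ : P ≪ Q) {ν : Measure Y} [SFinite ν]
    {w : X × Y → ENNReal} (hw : Measurable w) :
    ∫⁻ p, ENNReal.ofReal (exp (-llr P Q p.1)) * w p ∂(P.prod ν) ≤ ∫⁻ p, w p ∂(Q.prod ν) := by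
  have hL : Measurable (llr P Q) := measurable_llr P Q
  have hh : Measurable fun x => ∫⁻ y, w (x, y) ∂ν := hw.lintegral_prod_right'
  rw [lintegral_prod _ (by fun_prop), lintegral_prod _ hw.aemeasurable]
  calc
    _ = ∫⁻ x, (Q.rnDeriv P * fun x => ∫⁻ y, w (x, y) ∂ν) x ∂P := by
      refine lintegral_congr_ae ?_
      filter_upwards [exp_neg_llr hPQ, Q.rnDeriv_lt_top P] with x hx hx_top
      rw [lintegral_const_mul _ (by fun_prop), hx, ENNReal.ofReal_toReal hx_top.ne, Pi.mul_apply]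
    _ = ∫⁻ x, ∫⁻ y, w (x, y) ∂ν ∂(P.withDensity (Q.rnDeriv P)) :=
      (lintegral_withDensity_eq_lintegral_mul P (Q.measurable_rnDeriv P) hh).symm
    _ ≤ ∫⁻ x, ∫⁻ y, w (x, y) ∂ν ∂Q :=
      lintegral_mono' (Measure.withDensity_rnDeriv_le Q P) le_rfl

theorem stmt0 {X : Type*} [MeasurableSpace X] (P Q : Measure X)
    [IsProbabilityMeasure P] [IsProbabilityMeasure Q] (hPQ : P ≪ Q)
    (r : X → ℝ) (hr : Measurable r) (hrpos : ∀ x, 0 < r x) (m : ℕ) (hm : 2 ≤ m) :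
    ((∫ p : X × (Fin (m - 1) → X),
        Real.log ((m : ℝ) * r p.1 / (r p.1 + ∑ i : Fin (m - 1), r (p.2 i)))
        ∂(P.prod (Measure.pi fun _ : Fin (m - 1) => Q)) : ℝ) : EReal)
      ≤ klDiv P Q := by
  unfold klDiv
  split_ifs with h
  swap
  · exact le_top
  obtain ⟨n, rfl⟩ : ∃ n, m = n + 1 := ⟨m - 1, by omega⟩
  rw [EReal.coe_le_coe_iff]
  change ∫ p : X × (Fin n → X),
      Real.log (((n + 1 : ℕ) : ℝ) * r p.1 / (r p.1 + ∑ i : Fin n, r (p.2 i)))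
      ∂(P.prod (Measure.pi fun _ : Fin n => Q)) ≤ ∫ x, llr P Q x ∂P
  by_cases hF : Integrable (fun p : X × (Fin n → X) =>
      Real.log (((n + 1 : ℕ) : ℝ) * r p.1 / (r p.1 + ∑ i : Fin n, r (p.2 i))))
      (P.prod (Measure.pi fun _ : Fin n => Q))
  swap
  · rw [integral_undef hF]
    simpa using InformationTheory.integral_llr_add_sub_measure_univ_nonneg hPQ h.2
  have hL : Integrable (fun p : X × (Fin n → X) => llr P Q p.1)
      (P.prod (Measure.pi fun _ : Fin n => Q)) := h.2.comp_fst _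
  have hW : ∀ p : X × (Fin n → X),
      0 < ((n + 1 : ℕ) : ℝ) * r p.1 / (r p.1 + ∑ i : Fin n, r (p.2 i)) := fun p =>
    div_pos (mul_pos (by positivity) (hrpos _))
      (add_pos_of_pos_of_nonneg (hrpos _) (Finset.sum_nonneg fun i _ => (hrpos _).le))
  have key := integral_nonpos_of_lintegral_exp_le_one (hF.sub hL) <| by
    calc
      _ = ∫⁻ p : X × (Fin n → X), ENNReal.ofReal (exp (-llr P Q p.1)) *
            ENNReal.ofReal (((n + 1 : ℕ) : ℝ) * r p.1 / (r p.1 + ∑ i : Fin n, r (p.2 i)))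
            ∂(P.prod (Measure.pi fun _ : Fin n => Q)) := by
        refine lintegral_congr fun p => ?_
        rw [← ENNReal.ofReal_mul (exp_pos _).le, Pi.sub_apply, sub_eq_neg_add, exp_add,
          exp_log (hW p)]
      _ ≤ _ := lintegral_exp_neg_llr_mul_le hPQ (by fun_prop)
      _ = 1 := lintegral_prod_pi_mul_div_add_sum Q hr hrpos n
  rw [integral_sub' hF hL, integral_fun_fst (f := llr P Q)] at key
  simpa using key
end

section
/- Let X and Y be random variables with joint law p(x,y) on 𝒳 × 𝒴, such that p(x,y) is absolutely continuous with respect to the product p(x)p(y) of its marginals. For every integer n ≥ 1, every integer m ≥ 2, and every measurable critic g : 𝒳 × 𝒴 → ℝ with g > 0 everywhere, the CPC objective satisfies L(g) ≤ I(X; Y). -/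
open MeasureTheory Real
open scoped Classical

open ENNReal in
/-- Exchangeability: a positive score is on average the fraction `1 / (k + 1)` of the sum of
`k + 1` i.i.d. scores. -/
lemma natCast_mul_lintegral_score_div_sum {𝒴 : Type*} [MeasurableSpace 𝒴]
    (ν : Measure 𝒴) [IsProbabilityMeasure ν] (k : ℕ) {a : 𝒴 → ℝ} (ha : Measurable a)
    (hapos : ∀ y, 0 < a y) :
    ((k + 1 : ℕ) : ℝ≥0∞) * ∫⁻ y, ∫⁻ z, ENNReal.ofReal (a y / (a y + ∑ j : Fin k, a (z j)))
      ∂(Measure.pi fun _ : Fin k => ν) ∂ν = 1 := by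
  have key (i : Fin (k + 1)) :
      ∫⁻ w, ENNReal.ofReal (a (w i) / ∑ l, a (w l)) ∂(Measure.pi fun _ : Fin (k + 1) => ν) =
        ∫⁻ y, ∫⁻ z, ENNReal.ofReal (a y / (a y + ∑ j : Fin k, a (z j)))
          ∂(Measure.pi fun _ : Fin k => ν) ∂ν := by
    rw [← lintegral_prod
      (fun p : 𝒴 × (Fin k → 𝒴) => ENNReal.ofReal (a p.1 / (a p.1 + ∑ j : Fin k, a (p.2 j))))
      (by fun_prop)]
    rw [← (measurePreserving_piFinSuccAbove (fun _ : Fin (k + 1) => ν) i).lintegral_comp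
      (by fun_prop)]
    refine lintegral_congr fun w => ?_
    rw [Fin.sum_univ_succAbove (fun l => a (w l)) i]
    rfl
  have hsum (w : Fin (k + 1) → 𝒴) :
      ∑ i, ENNReal.ofReal (a (w i) / ∑ l, a (w l)) = 1 := by
    have hpos : 0 < ∑ l, a (w l) :=
      Finset.sum_pos (fun l _ => hapos _) Finset.univ_nonempty
    rw [← ENNReal.ofReal_sum_of_nonneg fun i _ => (div_pos (hapos _) hpos).le,
      ← Finset.sum_div, div_self hpos.ne', ENNReal.ofReal_one]
  calc _ = ∑ i : Fin (k + 1),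
        ∫⁻ w, ENNReal.ofReal (a (w i) / ∑ l, a (w l)) ∂(Measure.pi fun _ : Fin (k + 1) => ν) := by
        simp only [key, Finset.sum_const, Finset.card_univ, Fintype.card_fin, nsmul_eq_mul]
    _ = ∫⁻ w, ∑ i : Fin (k + 1), ENNReal.ofReal (a (w i) / ∑ l, a (w l))
          ∂(Measure.pi fun _ : Fin (k + 1) => ν) :=
        (lintegral_finsetSum _ fun i _ => by fun_prop).symm
    _ = 1 := by simp only [hsum, lintegral_one, measure_univ]

open ENNReal in
/-- Weighting by the inverse likelihood ratio changes `P` into at most `Q`. -/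
lemma lintegral_mul_exp_neg_llr_le {Z : Type*} [MeasurableSpace Z] (P Q : Measure Z)
    [IsFiniteMeasure P] [IsFiniteMeasure Q] (hPQ : P ≪ Q) {φ : Z → ℝ≥0∞} (hφ : Measurable φ) :
    ∫⁻ z, φ z * ENNReal.ofReal (Real.exp (-llr P Q z)) ∂P ≤ ∫⁻ z, φ z ∂Q := by
  have hw : Measurable fun z => φ z * ENNReal.ofReal (Real.exp (-llr P Q z)) := by fun_prop
  rw [← lintegral_rnDeriv_mul hPQ hw.aemeasurable]
  refine lintegral_mono_ae ?_
  filter_upwards [Measure.rnDeriv_lt_top P Q] with z hz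
  rw [mul_left_comm]
  refine mul_le_of_le_one_right' ?_
  by_cases h0 : P.rnDeriv Q z = 0
  · simp [h0]
  · have hpos := ENNReal.toReal_pos h0 hz.ne
    rw [llr, Real.exp_neg, Real.exp_log hpos, ENNReal.ofReal_inv_of_pos hpos,
      ENNReal.ofReal_toReal hz.ne]
    exact ENNReal.mul_inv_le_one _

/-- The ratio inside the logarithm of the CPC objective, for one positive pair and `k`
negative samples. -/
noncomputable def cpcRatio {𝒳 𝒴 : Type*} (g : 𝒳 × 𝒴 → ℝ) (k : ℕ)
    (q : (𝒳 × 𝒴) × (Fin k → 𝒴)) : ℝ :=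
  ((k + 1 : ℕ) : ℝ) * g q.1 / (g q.1 + ∑ j, g (q.1.1, q.2 j))

lemma measurable_cpcRatio {𝒳 𝒴 : Type*} [MeasurableSpace 𝒳] [MeasurableSpace 𝒴]
    {g : 𝒳 × 𝒴 → ℝ} (hg : Measurable g) (k : ℕ) : Measurable (cpcRatio g k) := by
  unfold cpcRatio
  fun_prop

lemma cpcRatio_pos {𝒳 𝒴 : Type*} {g : 𝒳 × 𝒴 → ℝ} (hgpos : ∀ p, 0 < g p) (k : ℕ)
    (q : (𝒳 × 𝒴) × (Fin k → 𝒴)) : 0 < cpcRatio g k q :=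
  div_pos (mul_pos (by positivity) (hgpos _))
    (add_pos_of_pos_of_nonneg (hgpos _) (Finset.sum_nonneg fun _ _ => (hgpos _).le))

/-- Under the product of the marginals, the CPC ratio has mean one. -/
lemma lintegral_cpcRatio_prod {𝒳 𝒴 : Type*} [MeasurableSpace 𝒳] [MeasurableSpace 𝒴]
    (ρ : Measure 𝒳) (ν : Measure 𝒴) [IsProbabilityMeasure ρ] [IsProbabilityMeasure ν]
    {g : 𝒳 × 𝒴 → ℝ} (hg : Measurable g) (hgpos : ∀ p, 0 < g p) (k : ℕ) :
    ∫⁻ p, ∫⁻ z, ENNReal.ofReal (cpcRatio g k (p, z)) ∂(Measure.pi fun _ : Fin k => ν)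
      ∂(ρ.prod ν) = 1 := by
  have hm : Measurable fun q => ENNReal.ofReal (cpcRatio g k q) :=
    (measurable_cpcRatio hg k).ennreal_ofReal
  rw [lintegral_prod _ hm.lintegral_prod_right'.aemeasurable]
  have hinner (x : 𝒳) : ∫⁻ y, ∫⁻ z, ENNReal.ofReal (cpcRatio g k ((x, y), z))
      ∂(Measure.pi fun _ : Fin k => ν) ∂ν = 1 := by
    have hgx : Measurable fun y => g (x, y) := by fun_prop
    rw [← natCast_mul_lintegral_score_div_sum ν k hgx fun y => hgpos (x, y),
      ← lintegral_const_mul' _ _ (ENNReal.natCast_ne_top _)]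
    refine lintegral_congr fun y => ?_
    rw [← lintegral_const_mul' _ _ (ENNReal.natCast_ne_top _)]
    refine lintegral_congr fun z => ?_
    rw [cpcRatio, mul_div_assoc, ENNReal.ofReal_mul (Nat.cast_nonneg _), ENNReal.ofReal_natCast]
  simp only [hinner, lintegral_one, measure_univ]

/-- The CPC ratio, divided by the density of the joint law, has mean at most one. -/
lemma lintegral_cpcRatio_mul_exp_neg_llr_le_one {𝒳 𝒴 : Type*} [MeasurableSpace 𝒳]
    [MeasurableSpace 𝒴] (μ : Measure (𝒳 × 𝒴)) [IsProbabilityMeasure μ]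
    (ρ : Measure 𝒳) (ν : Measure 𝒴) [IsProbabilityMeasure ρ] [IsProbabilityMeasure ν]
    (hac : μ ≪ ρ.prod ν) {g : 𝒳 × 𝒴 → ℝ} (hg : Measurable g) (hgpos : ∀ p, 0 < g p) (k : ℕ) :
    ∫⁻ q, ENNReal.ofReal (cpcRatio g k q * Real.exp (-llr μ (ρ.prod ν) q.1))
      ∂(μ.prod (Measure.pi fun _ : Fin k => ν)) ≤ 1 := by
  have hm := measurable_cpcRatio hg k
  have hm' : Measurable fun q => ENNReal.ofReal (cpcRatio g k q) := hm.ennreal_ofReal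
  rw [lintegral_prod _ (by fun_prop)]
  simp_rw [ENNReal.ofReal_mul (cpcRatio_pos hgpos k _).le]
  simp_rw [lintegral_mul_const' _ _ ENNReal.ofReal_ne_top]
  exact (lintegral_mul_exp_neg_llr_le μ _ hac hm'.lintegral_prod_right').trans_eq
    (lintegral_cpcRatio_prod ρ ν hg hgpos k)

lemma log_le_add_mul_exp_neg_sub_one {r : ℝ} (hr : 0 < r) (t : ℝ) :
    Real.log r ≤ t + r * Real.exp (-t) - 1 := by
  have h := Real.log_le_sub_one_of_pos (mul_pos hr (Real.exp_pos (-t)))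
  rw [Real.log_mul hr.ne' (Real.exp_pos _).ne', Real.log_exp] at h
  linarith

/-- The CPC objective with `k` negative samples per positive pair is at most the integral of the
log-likelihood ratio between the joint law and the product of the marginals. -/
lemma integral_cpc_le_integral_llr {𝒳 𝒴 : Type*} [MeasurableSpace 𝒳]
    [MeasurableSpace 𝒴] (μ : Measure (𝒳 × 𝒴)) [IsProbabilityMeasure μ]
    (ρ : Measure 𝒳) (ν : Measure 𝒴) [IsProbabilityMeasure ρ] [IsProbabilityMeasure ν]
    (hac : μ ≪ ρ.prod ν) (hint : Integrable (llr μ (ρ.prod ν)) μ)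
    {g : 𝒳 × 𝒴 → ℝ} (hg : Measurable g) (hgpos : ∀ p, 0 < g p) {n : ℕ} (hn : n ≠ 0) (k : ℕ) :
    ∫ p : (Fin n → 𝒳 × 𝒴) × (Fin n → Fin k → 𝒴),
        (1 / (n : ℝ)) * ∑ i : Fin n, Real.log (cpcRatio g k (p.1 i, p.2 i))
        ∂((Measure.pi fun _ : Fin n => μ).prod
            (Measure.pi fun _ : Fin n => Measure.pi fun _ : Fin k => ν))
      ≤ ∫ x, llr μ (ρ.prod ν) x ∂μ := by
  set P := (Measure.pi fun _ : Fin n => μ).prod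
    (Measure.pi fun _ : Fin n => Measure.pi fun _ : Fin k => ν)
  set ξ := μ.prod (Measure.pi fun _ : Fin k => ν)
  set ℓ := llr μ (ρ.prod ν)
  by_cases hI : Integrable (fun p : (Fin n → 𝒳 × 𝒴) × (Fin n → Fin k → 𝒴) =>
      (1 / (n : ℝ)) * ∑ i : Fin n, Real.log (cpcRatio g k (p.1 i, p.2 i))) P
  swap
  · rw [integral_undef hI]
    simpa using InformationTheory.integral_llr_add_sub_measure_univ_nonneg hac hint
  have hpres (i : Fin n) : MeasurePreserving
      (fun p : (Fin n → 𝒳 × 𝒴) × (Fin n → Fin k → 𝒴) => (p.1 i, p.2 i)) P ξ :=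
    (measurePreserving_eval (fun _ : Fin n => μ) i).prod
      (measurePreserving_eval (fun _ : Fin n => Measure.pi fun _ : Fin k => ν) i)
  let G (q : (𝒳 × 𝒴) × (Fin k → 𝒴)) : ℝ := cpcRatio g k q * Real.exp (-ℓ q.1)
  have hm := measurable_cpcRatio hg k
  have hGm : Measurable G := hm.mul (by fun_prop)
  have hG0 (q) : 0 ≤ G q := mul_nonneg (cpcRatio_pos hgpos k q).le (Real.exp_pos _).le
  have hGle : ∫⁻ q, ENNReal.ofReal (G q) ∂ξ ≤ 1 :=
    lintegral_cpcRatio_mul_exp_neg_llr_le_one μ ρ ν hac hg hgpos k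
  have hGint : Integrable G ξ :=
    ⟨hGm.aestronglyMeasurable, by
      rw [hasFiniteIntegral_iff_ofReal (.of_forall hG0)]
      exact hGle.trans_lt ENNReal.one_lt_top⟩
  have hGle' : ∫ q, G q ∂ξ ≤ 1 := by
    rw [integral_eq_lintegral_of_nonneg_ae (.of_forall hG0) hGm.aestronglyMeasurable]
    exact ENNReal.toReal_le_of_le_ofReal zero_le_one (by simpa using hGle)
  have hℓ : Integrable (fun q : (𝒳 × 𝒴) × (Fin k → 𝒴) => ℓ q.1) ξ := hint.comp_fst _
  let B (q : (𝒳 × 𝒴) × (Fin k → 𝒴)) : ℝ := ℓ q.1 + G q - 1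
  have hB : Integrable B ξ := (hℓ.add hGint).sub (integrable_const 1)
  have hBle : ∫ q, B q ∂ξ ≤ ∫ x, ℓ x ∂μ := by
    have h1 : ∫ q, B q ∂ξ = ∫ q, ℓ q.1 ∂ξ + ∫ q, G q ∂ξ - 1 := by
      refine (integral_sub (hℓ.add hGint) (integrable_const 1)).trans ?_
      rw [integral_add' hℓ hGint]
      simp
    have h2 : ∫ q, ℓ q.1 ∂ξ = ∫ x, ℓ x ∂μ := by
      simpa using integral_fun_fst (μ := μ) (ν := Measure.pi fun _ : Fin k => ν) ℓ
    linarith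
  have hBi (i : Fin n) : Integrable (fun p => B (p.1 i, p.2 i)) P :=
    (hpres i).integrable_comp_of_integrable hB
  have hBi' (i : Fin n) : ∫ p, B (p.1 i, p.2 i) ∂P = ∫ q, B q ∂ξ := by
    rw [← (hpres i).map_eq, integral_map (hpres i).aemeasurable]
    rw [(hpres i).map_eq]
    exact hB.aestronglyMeasurable
  calc _ ≤ ∫ p, (1 / (n : ℝ)) * ∑ i : Fin n, B (p.1 i, p.2 i) ∂P := by
        refine integral_mono hI ((integrable_finsetSum _ fun i _ => hBi i).const_mul _) fun p => ?_
        refine mul_le_mul_of_nonneg_left (Finset.sum_le_sum fun i _ => ?_) (by positivity)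
        exact log_le_add_mul_exp_neg_sub_one (cpcRatio_pos hgpos k _) _
    _ = ∫ q, B q ∂ξ := by
        rw [integral_const_mul, integral_finsetSum _ fun i _ => hBi i]
        simp [hBi', hn]
    _ ≤ _ := hBle

/-- CPC is a lower bound on the mutual information
`I(X;Y) = D_KL(p(x,y) ‖ p(x)p(y))`. The expectation defining `L(g)` is over `n`
positive pairs drawn i.i.d. from the joint law `μ` and, independently, `n(m-1)`
negative samples drawn i.i.d. from the marginal of `Y`. -/
theorem stmt1 {𝒳 𝒴 : Type*} [MeasurableSpace 𝒳] [MeasurableSpace 𝒴]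
    (μ : Measure (𝒳 × 𝒴)) [IsProbabilityMeasure μ]
    (hac : μ ≪ (μ.map Prod.fst).prod (μ.map Prod.snd))
    (n m : ℕ) (hn : 1 ≤ n) (hm : 2 ≤ m)
    (g : 𝒳 × 𝒴 → ℝ) (hg : Measurable g) (hgpos : ∀ p, 0 < g p) :
    ((∫ p : (Fin n → 𝒳 × 𝒴) × (Fin n → Fin (m - 1) → 𝒴),
        (1 / (n : ℝ)) * ∑ i : Fin n,
          Real.log ((m : ℝ) * g (p.1 i) /
            (g (p.1 i) + ∑ j : Fin (m - 1), g ((p.1 i).1, p.2 i j)))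
        ∂((Measure.pi fun _ : Fin n => μ).prod
            (Measure.pi fun _ : Fin n => Measure.pi fun _ : Fin (m - 1) => μ.map Prod.snd)) : ℝ) : EReal)
      ≤ klDiv μ ((μ.map Prod.fst).prod (μ.map Prod.snd)) := by
  have hρ : IsProbabilityMeasure (μ.map Prod.fst) :=
    Measure.isProbabilityMeasure_map measurable_fst.aemeasurable
  have hν : IsProbabilityMeasure (μ.map Prod.snd) :=
    Measure.isProbabilityMeasure_map measurable_snd.aemeasurable
  obtain ⟨k, rfl⟩ : ∃ k, m = k + 1 := ⟨m - 1, by omega⟩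
  unfold klDiv
  split_ifs with h
  · exact EReal.coe_le_coe_iff.mpr
      (integral_cpc_le_integral_llr μ _ _ hac h.2 hg hgpos (Nat.ne_of_gt hn) k)
  · exact le_top
end

section
/- Let X be a measurable space and let P and Q be probability measures on X with P absolutely continuous with respect to Q. Then for every measurable function r : X → ℝ with r(x) > 0 for all x, all integers n ≥ 1 and m ≥ 2, and every real number α with m/(n(m−1)+1) ≤ α ≤ 1, the KL divergence satisfies D_KL(P ‖ Q) ≥ E[ (1/n) Σ_{i=1}^{n} log( m n · r(x_i) / ( α Σ_{j=1}^{n} r(x_j) + ((m−α)/(m−1)) Σ_{j=1}^{n} Σ_{k=1}^{m-1} r(y_{j,k}) ) ) ], where the expectation is over x_1, …, x_n drawn i.i.d. from P and, independently, n(m−1) samples y_{j,k} (j ∈ {1,…,n}, k ∈ {1,…,m−1}) drawn i.i.d. from Q. -/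
open MeasureTheory Real
open scoped Classical

section Shares

variable {ι X : Type*} {r : X → ℝ}

/-- The fraction of the total weight `r` of the samples indexed by `s` carried by sample `i`. -/
noncomputable def share (r : X → ℝ) (s : Finset ι) (z : ι → X) (i : ι) : ℝ :=
  r (z i) / ∑ j ∈ s, r (z j)

lemma share_nonneg (hr : ∀ x, 0 < r x) (s : Finset ι) (z : ι → X) (i : ι) :
    0 ≤ share r s z i :=
  div_nonneg (hr _).le (Finset.sum_nonneg fun _ _ => (hr _).le)

lemma sum_share (hr : ∀ x, 0 < r x) {s : Finset ι} (hs : s.Nonempty) (z : ι → X) :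
    ∑ i ∈ s, share r s z i = 1 := by
  unfold share
  rw [← Finset.sum_div]
  exact div_self (Finset.sum_pos (fun _ _ => hr _) hs).ne'

lemma share_le_one (hr : ∀ x, 0 < r x) {s : Finset ι} {i : ι} (hi : i ∈ s) (z : ι → X) :
    share r s z i ≤ 1 := by
  rw [← sum_share hr ⟨i, hi⟩ z]
  exact Finset.single_le_sum (fun j _ => share_nonneg hr s z j) hi

lemma share_comp_swap {s : Finset ι} {j l : ι} (hj : j ∈ s) (hl : l ∈ s) (z : ι → X) (i : ι) :
    share r s (fun i => z (Equiv.swap j l i)) i = share r s z (Equiv.swap j l i) := by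
  unfold share
  congr 1
  refine Finset.sum_equiv (Equiv.swap j l) (fun i => ?_) fun _ _ => rfl
  rcases eq_or_ne i j with rfl | hij
  · simp [hj, hl]
  rcases eq_or_ne i l with rfl | hil
  · simp [hj, hl]
  · rw [Equiv.swap_apply_of_ne_of_ne hij hil]

variable [MeasurableSpace X]

@[fun_prop]
lemma measurable_share (hr : Measurable r) (s : Finset ι) (i : ι) :
    Measurable fun z : ι → X => share r s z i := by
  unfold share
  fun_prop

lemma mul_ofReal_div_toReal_le (a : ENNReal) (w : ℝ) :
    a * ENNReal.ofReal (w / a.toReal) ≤ ENNReal.ofReal w := by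
  rcases eq_or_ne a 0 with rfl | h0
  · simp
  rcases eq_or_ne a ⊤ with rfl | ht
  · simp
  have hpos : 0 < a.toReal := ENNReal.toReal_pos h0 ht
  rw [ENNReal.ofReal_div_of_pos hpos, ENNReal.ofReal_toReal ht, ENNReal.mul_div_cancel h0 ht]

variable (P Q : Measure X)

/-- The normalised product of shares over `A`, divided by the likelihood ratio of the samples
indexed by `A`. -/
noncomputable def shareRatio (r : X → ℝ) (s A : Finset ι) (z : ι → X) : ℝ :=
  (s.card : ℝ) ^ A.card * ∏ i ∈ A, share r s z i / (P.rnDeriv Q (z i)).toReal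

lemma shareRatio_nonneg (hrpos : ∀ x, 0 < r x) (s A : Finset ι) (z : ι → X) :
    0 ≤ shareRatio P Q r s A z :=
  mul_nonneg (by positivity) (Finset.prod_nonneg fun i _ =>
    div_nonneg (share_nonneg hrpos s z i) ENNReal.toReal_nonneg)

lemma measurable_shareRatio (hr : Measurable r) (s A : Finset ι) :
    Measurable (shareRatio P Q r s A) := by
  unfold shareRatio
  refine measurable_const.mul (Finset.measurable_prod _ fun i _ =>
    (measurable_share hr s i).div ?_)
  exact ((Measure.measurable_rnDeriv P Q).comp (measurable_pi_apply i)).ennreal_toReal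

lemma sum_log_card_mul_share_le (hrpos : ∀ x, 0 < r x) {s A : Finset ι} (hs : s.Nonempty)
    {z : ι → X} (hz : ∀ i ∈ A, 0 < (P.rnDeriv Q (z i)).toReal) :
    ∑ i ∈ A, log (s.card * share r s z i)
      ≤ ∑ i ∈ A, llr P Q (z i) + (shareRatio P Q r s A z - 1) := by
  have hcard : (0 : ℝ) < s.card := by exact_mod_cast Finset.card_pos.mpr hs
  have hw : ∀ i, 0 < share r s z i := fun i =>
    div_pos (hrpos _) (Finset.sum_pos (fun _ _ => hrpos _) hs)
  have hprod : shareRatio P Q r s A z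
      = ∏ i ∈ A, (s.card * share r s z i) / (P.rnDeriv Q (z i)).toReal := by
    rw [shareRatio, ← Finset.prod_const, ← Finset.prod_mul_distrib]
    simp_rw [mul_div_assoc]
  have hpos : ∀ i ∈ A, 0 < (s.card * share r s z i) / (P.rnDeriv Q (z i)).toReal :=
    fun i hi => div_pos (mul_pos hcard (hw i)) (hz i hi)
  have hlog := log_le_sub_one_of_pos (Finset.prod_pos hpos)
  rw [← hprod, hprod, log_prod fun i hi => (hpos i hi).ne', ← hprod] at hlog
  have hsplit : ∑ i ∈ A, log ((s.card * share r s z i) / (P.rnDeriv Q (z i)).toReal)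
      = ∑ i ∈ A, log (s.card * share r s z i) - ∑ i ∈ A, llr P Q (z i) := by
    rw [← Finset.sum_sub_distrib]
    exact Finset.sum_congr rfl fun i hi =>
      log_div (mul_pos hcard (hw i)).ne' (hz i hi).ne'
  linarith

end Shares

section ProductMeasures

variable {ι X : Type*} [Fintype ι] [MeasurableSpace X] {r : X → ℝ}

lemma pi_withDensity_eq (κ μ : ι → Measure X) [∀ i, IsProbabilityMeasure (κ i)]
    [∀ i, IsProbabilityMeasure (μ i)] (f : ι → X → ENNReal) (hf : ∀ i, Measurable (f i))
    (h : ∀ i, (κ i).withDensity (f i) = μ i) :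
    (Measure.pi κ).withDensity (fun z => ∏ i, f i (z i)) = Measure.pi μ := by
  refine (Measure.pi_eq fun s hs => ?_).symm
  rw [withDensity_apply _ (MeasurableSet.univ_pi hs),
    ← lintegral_indicator (MeasurableSet.univ_pi hs)]
  have hprod : ∀ z : ι → X, (Set.univ.pi s).indicator (fun z => ∏ i, f i (z i)) z
      = ∏ i, (s i).indicator (f i) (z i) := by
    intro z
    by_cases hz : z ∈ Set.univ.pi s
    · rw [Set.indicator_of_mem hz]
      exact Finset.prod_congr rfl fun i _ =>
        (Set.indicator_of_mem (hz i (Set.mem_univ i)) (f i)).symm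
    · rw [Set.indicator_of_notMem hz]
      simp only [Set.mem_univ_pi, not_forall] at hz
      obtain ⟨i, hi⟩ := hz
      exact (Finset.prod_eq_zero (Finset.mem_univ i) (Set.indicator_of_notMem hi (f i))).symm
  have hmeas : ∀ i, Measurable ((s i).indicator (f i)) := fun i => (hf i).indicator (hs i)
  simp_rw [hprod]
  rw [ProbabilityTheory.lintegral_prod_eq_prod_lintegral_of_indepFun Finset.univ
    (fun i (z : ι → X) => (s i).indicator (f i) (z i))
    (ProbabilityTheory.iIndepFun_pi fun i => (hmeas i).aemeasurable)
    (fun i => (hmeas i).comp (measurable_pi_apply i))]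
  refine Finset.prod_congr rfl fun i _ => ?_
  rw [(measurePreserving_eval κ i).lintegral_comp (hmeas i), lintegral_indicator (hs i),
    ← withDensity_apply _ (hs i), h i]

lemma measurePreserving_comp_swap (κ : ι → Measure X) [∀ i, IsProbabilityMeasure (κ i)]
    {j l : ι} (h : κ j = κ l) :
    MeasurePreserving (fun (z : ι → X) i => z (Equiv.swap j l i))
      (Measure.pi κ) (Measure.pi κ) := by
  have hmeas : Measurable fun (z : ι → X) i => z (Equiv.swap j l i) :=
    measurable_pi_lambda _ fun i => measurable_pi_apply _
  have hκ : ∀ i, κ (Equiv.swap j l i) = κ i := by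
    intro i
    rcases eq_or_ne i j with rfl | hj
    · rw [Equiv.swap_apply_left, h]
    rcases eq_or_ne i l with rfl | hl
    · rw [Equiv.swap_apply_right, h]
    · rw [Equiv.swap_apply_of_ne_of_ne hj hl]
  refine ⟨hmeas, (Measure.pi_eq fun s hs => ?_).symm⟩
  rw [Measure.map_apply hmeas (MeasurableSet.univ_pi hs)]
  have hpre : (fun (z : ι → X) i => z (Equiv.swap j l i)) ⁻¹' Set.univ.pi s
      = Set.univ.pi fun i => s (Equiv.swap j l i) := by
    ext z
    simp only [Set.mem_preimage, Set.mem_univ_pi]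
    exact ⟨fun hz i => by simpa using hz (Equiv.swap j l i),
      fun hz i => by simpa using hz (Equiv.swap j l i)⟩
  rw [hpre, Measure.pi_pi, ← Equiv.prod_comp (Equiv.swap j l) fun i => κ i (s i)]
  simp_rw [hκ]

variable (κ : ι → Measure X) [∀ i, IsProbabilityMeasure (κ i)]

lemma integrable_prod_share (hr : Measurable r) (hrpos : ∀ x, 0 < r x) {s A : Finset ι}
    (hA : A ⊆ s) : Integrable (fun z => ∏ i ∈ A, share r s z i) (Measure.pi κ) := by
  refine Integrable.of_bound (C := 1) (by fun_prop (disch := assumption)) (ae_of_all _ fun z => ?_)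
  rw [Real.norm_of_nonneg (Finset.prod_nonneg fun i _ => share_nonneg hrpos s z i)]
  exact Finset.prod_le_one (fun i _ => share_nonneg hrpos s z i)
    fun i hi => share_le_one hrpos (hA hi) z

lemma integrable_prod_share_mul (hr : Measurable r) (hrpos : ∀ x, 0 < r x) {s A : Finset ι}
    (hA : A ⊆ s) {l : ι} (hl : l ∈ s) :
    Integrable (fun z => (∏ i ∈ A, share r s z i) * share r s z l) (Measure.pi κ) :=
  (integrable_prod_share κ hr hrpos hA).mul_bdd (c := 1)
    (measurable_share hr s l).aestronglyMeasurable (ae_of_all _ fun z => by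
      rw [Real.norm_of_nonneg (share_nonneg hrpos s z l)]
      exact share_le_one hrpos hl z)

lemma integral_prod_share_mul_le (hr : Measurable r) (hrpos : ∀ x, 0 < r x) {s A : Finset ι}
    (hκ : ∀ i ∈ s, ∀ j ∈ s, κ i = κ j) (hA : A ⊆ s) {j l : ι} (hj : j ∈ s) (hl : l ∈ s)
    (hjA : j ∉ A) :
    ∫ z, (∏ i ∈ A, share r s z i) * share r s z j ∂Measure.pi κ
      ≤ ∫ z, (∏ i ∈ A, share r s z i) * share r s z l ∂Measure.pi κ := by
  have hint := integrable_prod_share_mul κ hr hrpos hA hl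
  have hmp := measurePreserving_comp_swap κ (hκ j hj l hl)
  have hint' := hmp.integrable_comp_of_integrable hint
  have hswap : ∫ z, ((∏ i ∈ A, share r s z (Equiv.swap j l i)) * share r s z j) ∂Measure.pi κ
      = ∫ z, (∏ i ∈ A, share r s z i) * share r s z l ∂Measure.pi κ := by
    have h := integral_map (μ := Measure.pi κ) hmp.aemeasurable
      (f := fun z => (∏ i ∈ A, share r s z i) * share r s z l)
      (by rw [hmp.map_eq]; exact hint.aestronglyMeasurable)
    rw [hmp.map_eq] at h
    rw [h]
    simp only [share_comp_swap hj hl, Equiv.swap_apply_right]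
  simp only [Function.comp_def, share_comp_swap hj hl, Equiv.swap_apply_right] at hint'
  by_cases hlA : l ∈ A
  · have hR : ∀ z, ∏ i ∈ A, share r s z (Equiv.swap j l i)
        = share r s z j * ∏ i ∈ A.erase l, share r s z i := by
      intro z
      rw [← Finset.mul_prod_erase A _ hlA, Equiv.swap_apply_right]
      congr 1
      refine Finset.prod_congr rfl fun i hi => ?_
      rw [Equiv.swap_apply_of_ne_of_ne (ne_of_mem_of_not_mem (Finset.mem_of_mem_erase hi) hjA)
        (Finset.ne_of_mem_erase hi)]
    have hsum := integral_add hint hint'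
    have hle := integral_mono ((integrable_prod_share_mul κ hr hrpos hA hj).const_mul 2)
      (hint.add hint') fun z => by
        simp only [Pi.add_apply, hR z]
        rw [← Finset.mul_prod_erase A _ hlA]
        have hRnn := Finset.prod_nonneg (s := A.erase l) fun i _ => share_nonneg hrpos s z i
        nlinarith [mul_nonneg hRnn (sq_nonneg (share r s z j - share r s z l))]
    rw [integral_const_mul] at hle
    simp only [Pi.add_apply] at hle
    rw [hsum, hswap] at hle
    linarith
  · rw [← hswap]
    refine le_of_eq (integral_congr_ae (ae_of_all _ fun z => ?_))
    simp only
    congr 1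
    refine Finset.prod_congr rfl fun i hi => ?_
    rw [Equiv.swap_apply_of_ne_of_ne (ne_of_mem_of_not_mem hi hjA) (ne_of_mem_of_not_mem hi hlA)]

/-- A probabilistic form of Maclaurin's inequality for exchangeable samples. -/
lemma integral_prod_share_le (hr : Measurable r) (hrpos : ∀ x, 0 < r x) {s A : Finset ι}
    (hκ : ∀ i ∈ s, ∀ j ∈ s, κ i = κ j) (hA : A ⊆ s) :
    ∫ z, ∏ i ∈ A, share r s z i ∂Measure.pi κ ≤ ((s.card : ℝ) ^ A.card)⁻¹ := by
  induction A using Finset.induction_on with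
  | empty => simp
  | insert j A hjA ih =>
    have hj : j ∈ s := hA (Finset.mem_insert_self j A)
    have hAs : A ⊆ s := (Finset.subset_insert j A).trans hA
    have hcard : (0 : ℝ) < s.card := by exact_mod_cast Finset.card_pos.mpr ⟨j, hj⟩
    have hexp : ∫ z, ∏ i ∈ A, share r s z i ∂Measure.pi κ
        = ∑ l ∈ s, ∫ z, (∏ i ∈ A, share r s z i) * share r s z l ∂Measure.pi κ := by
      rw [← integral_finsetSum _ fun l hl => integrable_prod_share_mul κ hr hrpos hAs hl]
      simp_rw [← Finset.mul_sum, sum_share hrpos ⟨j, hj⟩, mul_one]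
    have hle : (s.card : ℝ) * ∫ z, (∏ i ∈ A, share r s z i) * share r s z j ∂Measure.pi κ
        ≤ ∫ z, ∏ i ∈ A, share r s z i ∂Measure.pi κ := by
      rw [hexp, ← nsmul_eq_mul]
      exact Finset.card_nsmul_le_sum _ _ _ fun l hl =>
        integral_prod_share_mul_le κ hr hrpos hκ hAs hj hl hjA
    simp_rw [Finset.prod_insert hjA, mul_comm (share r s _ j)]
    rw [Finset.card_insert_of_notMem hjA, pow_succ, mul_inv, ← div_eq_mul_inv, le_div_iff₀ hcard]
    linarith [ih hAs]

variable (P Q : Measure X) [IsProbabilityMeasure P] [IsProbabilityMeasure Q]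

lemma lintegral_shareRatio_le (hPQ : P ≪ Q) (hr : Measurable r) (hrpos : ∀ x, 0 < r x)
    {s A : Finset ι} (hA : A ⊆ s) (hκA : ∀ i ∈ A, κ i = P) (hκs : ∀ i ∈ s \ A, κ i = Q) :
    ∫⁻ z, ENNReal.ofReal (shareRatio P Q r s A z) ∂Measure.pi κ ≤ 1 := by
  rcases A.eq_empty_or_nonempty with rfl | hne
  · simp [shareRatio]
  have hcard : (0 : ℝ) < (s.card : ℝ) ^ A.card := by
    have : 0 < s.card := Finset.card_pos.mpr (hne.mono hA)
    positivity
  let ν : ι → Measure X := fun i => if i ∈ A then Q else κ i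
  let f : ι → X → ENNReal := fun i => if i ∈ A then P.rnDeriv Q else 1
  have hν : ∀ i, IsProbabilityMeasure (ν i) := fun i => by
    by_cases hi : i ∈ A <;> simp only [ν, hi, if_true, if_false] <;> infer_instance
  have hf : ∀ i, Measurable (f i) := fun i => by
    by_cases hi : i ∈ A
    · simpa only [f, hi, if_true] using Measure.measurable_rnDeriv P Q
    · simpa only [f, hi, if_false] using measurable_one
  have hνs : ∀ i ∈ s, ν i = Q := fun i his => by
    by_cases hi : i ∈ A
    · simp only [ν, hi, if_true]
    · simpa only [ν, hi, if_false] using hκs i (Finset.mem_sdiff.mpr ⟨his, hi⟩)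
  have hpi := pi_withDensity_eq ν κ f hf fun i => by
    by_cases hi : i ∈ A
    · simp only [ν, f, hi, if_true, hκA i hi, Measure.withDensity_rnDeriv_eq _ _ hPQ]
    · simp only [ν, f, hi, if_false, withDensity_one]
  have hfprod : ∀ z : ι → X, ∏ i, f i (z i) = ∏ i ∈ A, P.rnDeriv Q (z i) := fun z => by
    rw [← Finset.prod_subset (Finset.subset_univ A) fun i _ hi => by simp [f, hi]]
    exact Finset.prod_congr rfl fun i hi => by simp [f, hi]
  have hint := (integrable_prod_share ν hr hrpos hA).const_mul ((s.card : ℝ) ^ A.card)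
  have hfmeas : Measurable fun z : ι → X => ∏ i, f i (z i) :=
    Finset.measurable_prod _ fun i _ => (hf i).comp (measurable_pi_apply i)
  rw [← hpi, lintegral_withDensity_eq_lintegral_mul _ hfmeas
    (measurable_shareRatio P Q hr s A).ennreal_ofReal]
  calc ∫⁻ z, ((fun z : ι → X => ∏ i, f i (z i)) *
          fun z : ι → X => ENNReal.ofReal (shareRatio P Q r s A z)) z ∂Measure.pi ν
      ≤ ∫⁻ z, ENNReal.ofReal ((s.card : ℝ) ^ A.card * ∏ i ∈ A, share r s z i) ∂Measure.pi ν := by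
        refine lintegral_mono fun z => ?_
        simp only [Pi.mul_apply, hfprod z, shareRatio]
        rw [ENNReal.ofReal_mul hcard.le, ENNReal.ofReal_mul hcard.le, mul_left_comm,
          ENNReal.ofReal_prod_of_nonneg fun i _ => share_nonneg hrpos s z i,
          ENNReal.ofReal_prod_of_nonneg fun i _ =>
            div_nonneg (share_nonneg hrpos s z i) ENNReal.toReal_nonneg,
          ← Finset.prod_mul_distrib]
        gcongr
        exact mul_ofReal_div_toReal_le _ _
    _ = ENNReal.ofReal ((s.card : ℝ) ^ A.card * ∫ z, ∏ i ∈ A, share r s z i ∂Measure.pi ν) := by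
        rw [← ofReal_integral_eq_lintegral_ofReal hint (ae_of_all _ fun z =>
          mul_nonneg hcard.le (Finset.prod_nonneg fun i _ => share_nonneg hrpos s z i)),
          integral_const_mul]
    _ ≤ 1 := by
        rw [← ENNReal.ofReal_one]
        refine ENNReal.ofReal_le_ofReal ?_
        rw [← mul_inv_cancel₀ hcard.ne']
        gcongr
        exact integral_prod_share_le ν hr hrpos
          (fun i hi j hj => (hνs i hi).trans (hνs j hj).symm) hA

lemma integrable_shareRatio (hPQ : P ≪ Q) (hr : Measurable r) (hrpos : ∀ x, 0 < r x)
    {s A : Finset ι} (hA : A ⊆ s) (hκA : ∀ i ∈ A, κ i = P) (hκs : ∀ i ∈ s \ A, κ i = Q) :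
    Integrable (shareRatio P Q r s A) (Measure.pi κ) := by
  refine ⟨(measurable_shareRatio P Q hr s A).aestronglyMeasurable, ?_⟩
  rw [hasFiniteIntegral_iff_ofReal (ae_of_all _ (shareRatio_nonneg P Q hrpos s A))]
  exact (lintegral_shareRatio_le κ P Q hPQ hr hrpos hA hκA hκs).trans_lt ENNReal.one_lt_top

lemma integral_shareRatio_le (hPQ : P ≪ Q) (hr : Measurable r) (hrpos : ∀ x, 0 < r x)
    {s A : Finset ι} (hA : A ⊆ s) (hκA : ∀ i ∈ A, κ i = P) (hκs : ∀ i ∈ s \ A, κ i = Q) :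
    ∫ z, shareRatio P Q r s A z ∂Measure.pi κ ≤ 1 := by
  rw [integral_eq_lintegral_of_nonneg_ae (ae_of_all _ (shareRatio_nonneg P Q hrpos s A))
    (measurable_shareRatio P Q hr s A).aestronglyMeasurable]
  exact ENNReal.toReal_le_of_le_ofReal zero_le_one
    (by simpa using lintegral_shareRatio_le κ P Q hPQ hr hrpos hA hκA hκs)

end ProductMeasures

/-- Interpolation in `α` between the multi-label bound and the average of the single-label bounds,
for arbitrary positive weights. -/
lemma mean_log_reweighted_le {ι : Type*} {A B : Finset ι} (hA : A.Nonempty) (hB : B.Nonempty)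
    {x : ι → ℝ} (hx : ∀ i, 0 < x i) {t α N : ℝ} (hN : 0 < N) (ht0 : 0 ≤ t) (ht1 : t ≤ 1)
    (hα : α = t + (1 - t) * (N / (A.card * (B.card + 1)))) (hNAB : N = A.card + B.card) :
    (1 / (A.card : ℝ)) * ∑ i ∈ A, log (N * x i /
        (α * ∑ j ∈ A, x j + (N - α * A.card) / B.card * ∑ j ∈ B, x j))
      ≤ t * ((1 / (A.card : ℝ)) * ∑ i ∈ A, log (N * (x i / (∑ j ∈ A, x j + ∑ j ∈ B, x j))))
        + (1 - t) * ((1 / (A.card : ℝ)) *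
          ∑ i ∈ A, log ((B.card + 1) * (x i / (x i + ∑ j ∈ B, x j)))) := by
  have hn : (0 : ℝ) < A.card := by exact_mod_cast Finset.card_pos.mpr hA
  have hc : (0 : ℝ) < B.card := by exact_mod_cast Finset.card_pos.mpr hB
  have hX : 0 < ∑ j ∈ A, x j := Finset.sum_pos (fun _ _ => hx _) hA
  have hY : 0 < ∑ j ∈ B, x j := Finset.sum_pos (fun _ _ => hx _) hB
  set X := ∑ j ∈ A, x j with hXdef
  set Y := ∑ j ∈ B, x j
  set n : ℝ := (A.card : ℝ) with hndef
  set c : ℝ := (B.card : ℝ)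
  have hS : α * X + (N - α * n) / c * Y
      = t * (X + Y) + (1 - t) * (N / (c + 1) * (X / n + Y)) := by
    have hne : c + 1 ≠ 0 := by positivity
    rw [hα, hNAB]
    field_simp
    ring
  have hXY : 0 < X + Y := by positivity
  have hZ : 0 < X / n + Y := by positivity
  have hZ' : 0 < N / (c + 1) * (X / n + Y) := by positivity
  have hSpos : 0 < α * X + (N - α * n) / c * Y := by
    rw [hS]
    rcases ht0.eq_or_lt with rfl | ht
    · simpa using hZ'
    · exact add_pos_of_pos_of_nonneg (mul_pos ht hXY) (mul_nonneg (sub_nonneg.mpr ht1) hZ'.le)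
  have hconc : t * log (X + Y) + (1 - t) * (log N - log (c + 1) + log (X / n + Y))
      ≤ log (α * X + (N - α * n) / c * Y) := by
    have h := strictConcaveOn_log_Ioi.concaveOn.2 (Set.mem_Ioi.mpr hXY) (Set.mem_Ioi.mpr hZ')
      ht0 (sub_nonneg.mpr ht1) (by ring)
    rw [log_mul (by positivity) hZ.ne', log_div hN.ne' (by positivity)] at h
    rw [hS]
    simpa only [smul_eq_mul] using h
  have hjensen : 1 / n * ∑ i ∈ A, log (x i + Y) ≤ log (X / n + Y) := by
    have h := strictConcaveOn_log_Ioi.concaveOn.le_map_sum (t := A) (w := fun _ => 1 / n)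
      (p := fun i => x i + Y) (fun _ _ => by positivity)
      (by rw [Finset.sum_const, nsmul_eq_mul, ← hndef]; field_simp)
      fun i _ => Set.mem_Ioi.mpr (add_pos (hx i) hY)
    simp only [smul_eq_mul, ← Finset.mul_sum] at h
    refine h.trans_eq (congrArg log ?_)
    rw [Finset.sum_add_distrib, Finset.sum_const, nsmul_eq_mul, ← hndef, ← hXdef]
    field_simp
  have h1 : ∑ i ∈ A, log (N * x i / (α * X + (N - α * n) / c * Y))
      = n * log N + ∑ i ∈ A, log (x i) - n * log (α * X + (N - α * n) / c * Y) := by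
    rw [Finset.sum_congr rfl fun i _ => by
      rw [log_div (mul_pos hN (hx i)).ne' hSpos.ne', log_mul hN.ne' (hx i).ne']]
    rw [Finset.sum_sub_distrib, Finset.sum_add_distrib]
    simp only [Finset.sum_const, nsmul_eq_mul, ← hndef]
  have h2 : ∑ i ∈ A, log (N * (x i / (X + Y)))
      = n * log N + ∑ i ∈ A, log (x i) - n * log (X + Y) := by
    rw [Finset.sum_congr rfl fun i _ => by
      rw [← mul_div_assoc, log_div (mul_pos hN (hx i)).ne' hXY.ne', log_mul hN.ne' (hx i).ne']]
    rw [Finset.sum_sub_distrib, Finset.sum_add_distrib]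
    simp only [Finset.sum_const, nsmul_eq_mul, ← hndef]
  have h3 : ∑ i ∈ A, log ((c + 1) * (x i / (x i + Y)))
      = n * log (c + 1) + ∑ i ∈ A, log (x i) - ∑ i ∈ A, log (x i + Y) := by
    rw [Finset.sum_congr rfl fun i _ => by
      rw [← mul_div_assoc, log_div (mul_pos (by positivity) (hx i)).ne' (add_pos (hx i) hY).ne',
        log_mul (by positivity) (hx i).ne']]
    rw [Finset.sum_sub_distrib, Finset.sum_add_distrib]
    simp only [Finset.sum_const, nsmul_eq_mul, ← hndef]
  rw [h1, h2, h3]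
  have hmul := mul_le_mul_of_nonneg_left hjensen (sub_nonneg.mpr ht1)
  have key : ∀ a b d : ℝ, 1 / n * (n * a + b - n * d) = a + 1 / n * b - d := fun a b d => by
    field_simp
  have key' : ∀ a b d : ℝ, 1 / n * (n * a + b - d) = a + 1 / n * b - 1 / n * d := fun a b d => by
    field_simp
  rw [key, key, key']
  linarith

section Domination

variable {ι X : Type*} [Fintype ι] [MeasurableSpace X] {r : X → ℝ}
  (κ : ι → Measure X) [∀ i, IsProbabilityMeasure (κ i)]
  (P Q : Measure X) [IsProbabilityMeasure P] [IsProbabilityMeasure Q]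

lemma integral_mean_log_reweighted_le (hPQ : P ≪ Q) (hllr : Integrable (llr P Q) P)
    (hr : Measurable r) (hrpos : ∀ x, 0 < r x) {A B : Finset ι} (hA : A.Nonempty)
    (hB : B.Nonempty) (hAB : Disjoint A B) (hκA : ∀ i ∈ A, κ i = P) (hκB : ∀ i ∈ B, κ i = Q)
    {α N : ℝ} (hNAB : N = A.card + B.card)
    (hα : N / (A.card * (B.card + 1)) ≤ α) (hα1 : α ≤ 1) :
    ∫ z, (1 / (A.card : ℝ)) * ∑ i ∈ A, log (N * r (z i) /
        (α * ∑ j ∈ A, r (z j) + (N - α * A.card) / B.card * ∑ j ∈ B, r (z j))) ∂Measure.pi κ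
      ≤ ∫ x, llr P Q x ∂P := by
  by_cases hint : Integrable (fun z => (1 / (A.card : ℝ)) * ∑ i ∈ A, log (N * r (z i) /
      (α * ∑ j ∈ A, r (z j) + (N - α * A.card) / B.card * ∑ j ∈ B, r (z j)))) (Measure.pi κ)
  swap
  · rw [integral_undef hint]
    simpa using InformationTheory.integral_llr_add_sub_measure_univ_nonneg hPQ hllr
  have hn : (0 : ℝ) < A.card := by exact_mod_cast Finset.card_pos.mpr hA
  have hc : (0 : ℝ) < B.card := by exact_mod_cast Finset.card_pos.mpr hB
  obtain ⟨u, t, hu, ht, hut, htα⟩ := Icc_subset_segment (𝕜 := ℝ) ⟨hα, hα1⟩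
  obtain rfl : u = 1 - t := by linarith
  simp only [smul_eq_mul, mul_one] at htα
  have hllrA : ∀ i ∈ A, Integrable (fun z : ι → X => llr P Q (z i)) (Measure.pi κ) :=
    fun i hi => integrable_comp_eval (by rwa [hκA i hi])
  have hllrA' : ∀ i ∈ A, ∫ z : ι → X, llr P Q (z i) ∂Measure.pi κ = ∫ x, llr P Q x ∂P := by
    intro i hi
    rw [integral_comp_eval (by rw [hκA i hi]; exact hllr.aestronglyMeasurable), hκA i hi]
  have hiB : ∀ i ∈ A, i ∉ B := fun i hi => Finset.disjoint_left.mp hAB hi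
  have hmA : Integrable (shareRatio P Q r (A ∪ B) A) (Measure.pi κ) ∧
      ∫ z, shareRatio P Q r (A ∪ B) A z ∂Measure.pi κ ≤ 1 := by
    have h : ∀ i ∈ (A ∪ B) \ A, κ i = Q := fun i hi => hκB i (by
      simp only [Finset.mem_sdiff, Finset.mem_union] at hi; tauto)
    exact ⟨integrable_shareRatio κ P Q hPQ hr hrpos Finset.subset_union_left hκA h,
      integral_shareRatio_le κ P Q hPQ hr hrpos Finset.subset_union_left hκA h⟩
  have hmi : ∀ i ∈ A, Integrable (shareRatio P Q r (insert i B) {i}) (Measure.pi κ) ∧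
      ∫ z, shareRatio P Q r (insert i B) {i} z ∂Measure.pi κ ≤ 1 := by
    intro i hi
    have hsub : {i} ⊆ insert i B := by simp
    have h1 : ∀ j ∈ ({i} : Finset ι), κ j = P := fun j hj => by
      rw [Finset.mem_singleton.mp hj, hκA i hi]
    have h2 : ∀ j ∈ insert i B \ {i}, κ j = Q := fun j hj => hκB j (by
      simp only [Finset.mem_sdiff, Finset.mem_insert, Finset.mem_singleton] at hj; tauto)
    exact ⟨integrable_shareRatio κ P Q hPQ hr hrpos hsub h1 h2,
      integral_shareRatio_le κ P Q hPQ hr hrpos hsub h1 h2⟩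
  have hmA' : Integrable (fun z => shareRatio P Q r (A ∪ B) A z - 1) (Measure.pi κ) :=
    hmA.1.sub (integrable_const 1)
  have hmi' : ∀ i ∈ A, Integrable (fun z => shareRatio P Q r (insert i B) {i} z - 1)
      (Measure.pi κ) := fun i hi => (hmi i hi).1.sub (integrable_const 1)
  have hint1 : Integrable (fun z => ∑ i ∈ A, llr P Q (z i)
      + (shareRatio P Q r (A ∪ B) A z - 1)) (Measure.pi κ) :=
    (integrable_finsetSum _ hllrA).add hmA'
  have hint2 : ∀ i ∈ A, Integrable (fun z => llr P Q (z i)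
      + (shareRatio P Q r (insert i B) {i} z - 1)) (Measure.pi κ) :=
    fun i hi => (hllrA i hi).add (hmi' i hi)
  have hle1 : ∫ z, (∑ i ∈ A, llr P Q (z i) + (shareRatio P Q r (A ∪ B) A z - 1)) ∂Measure.pi κ
      ≤ A.card * ∫ x, llr P Q x ∂P := by
    rw [integral_add (integrable_finsetSum _ hllrA) hmA',
      integral_finsetSum _ hllrA, Finset.sum_congr rfl hllrA',
      integral_sub hmA.1 (integrable_const 1)]
    simp only [Finset.sum_const, nsmul_eq_mul, integral_const, probReal_univ, smul_eq_mul, mul_one]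
    linarith [hmA.2]
  have hle2 : ∀ i ∈ A, ∫ z, (llr P Q (z i)
      + (shareRatio P Q r (insert i B) {i} z - 1)) ∂Measure.pi κ ≤ ∫ x, llr P Q x ∂P := by
    intro i hi
    rw [integral_add (hllrA i hi) (hmi' i hi), hllrA' i hi,
      integral_sub (hmi i hi).1 (integrable_const 1)]
    simp only [integral_const, probReal_univ, smul_eq_mul, mul_one]
    linarith [(hmi i hi).2]
  have hae : ∀ᵐ z ∂Measure.pi κ, ∀ i ∈ A, 0 < (P.rnDeriv Q (z i)).toReal := by
    refine ae_all_iff.mpr fun i => ?_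
    by_cases hi : i ∈ A
    · have h := (Measure.quasiMeasurePreserving_eval κ i).ae
        (p := fun x => 0 < (P.rnDeriv Q x).toReal) (by
          rw [hκA i hi]
          filter_upwards [Measure.rnDeriv_pos hPQ, hPQ.ae_le (Measure.rnDeriv_ne_top P Q)]
            with x h0 ht using ENNReal.toReal_pos h0.ne' ht)
      filter_upwards [h] with z hz _ using hz
    · exact ae_of_all _ fun z h => absurd h hi
  refine (integral_mono_ae hint (((hint1.const_mul (1 / (A.card : ℝ))).const_mul t).add
    (((integrable_finsetSum A hint2).const_mul (1 / (A.card : ℝ))).const_mul (1 - t))) ?_).trans ?_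
  · filter_upwards [hae] with z hz
    refine (mean_log_reweighted_le hA hB (x := fun i => r (z i)) (fun i => hrpos _)
      (by rw [hNAB]; positivity) ht (by linarith) (by linarith) hNAB).trans ?_
    simp only [Pi.add_apply]
    gcongr
    · have h := sum_log_card_mul_share_le P Q hrpos (s := A ∪ B) (hA.mono Finset.subset_union_left)
        hz
      rw [Finset.card_union_of_disjoint hAB] at h
      simpa only [share, Finset.sum_union hAB, Nat.cast_add, ← hNAB] using h
    · rename_i i hi
      have h := sum_log_card_mul_share_le P Q hrpos (s := insert i B) (A := {i}) (z := z)
        (Finset.insert_nonempty i B) fun j hj => by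
          rw [Finset.mem_singleton.mp hj]; exact hz i hi
      rw [Finset.card_insert_of_notMem (hiB i hi)] at h
      simpa only [share, Finset.sum_insert (hiB i hi), Finset.sum_singleton, Nat.cast_add,
        Nat.cast_one] using h
  · simp only [Pi.add_apply]
    rw [integral_add ((hint1.const_mul _).const_mul t)
      (((integrable_finsetSum A hint2).const_mul _).const_mul _)]
    simp only [integral_const_mul]
    rw [integral_finsetSum _ hint2]
    have hsum := Finset.sum_le_sum hle2
    rw [Finset.sum_const, nsmul_eq_mul] at hsum
    have hcancel : ∀ y : ℝ, 1 / (A.card : ℝ) * (A.card * y) = y := fun y => by field_simp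
    have h1 := mul_le_mul_of_nonneg_left hle1 (one_div_pos.mpr hn).le
    have h2 := mul_le_mul_of_nonneg_left hsum (one_div_pos.mpr hn).le
    rw [hcancel] at h1 h2
    have h1' := mul_le_mul_of_nonneg_left h1 ht
    have h2' := mul_le_mul_of_nonneg_left h2 hu
    linarith

end Domination

lemma measurePreserving_sumElim_uncurry {ι₁ ι₂ ι₃ X : Type*} [Fintype ι₁] [Fintype ι₂] [Fintype ι₃]
    [MeasurableSpace X] (P Q : Measure X) [IsProbabilityMeasure P] [IsProbabilityMeasure Q] :
    MeasurePreserving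
      (fun (p : (ι₁ → X) × (ι₂ → ι₃ → X)) => Sum.elim p.1 fun jk : ι₂ × ι₃ => p.2 jk.1 jk.2)
      ((Measure.pi fun _ => P).prod (Measure.pi fun _ => Measure.pi fun _ => Q))
      (Measure.pi (Sum.elim (fun _ : ι₁ => P) fun _ : ι₂ × ι₃ => Q)) := by
  have hmeas : Measurable fun (p : (ι₁ → X) × (ι₂ → ι₃ → X)) =>
      Sum.elim p.1 fun jk : ι₂ × ι₃ => p.2 jk.1 jk.2 := by
    refine measurable_pi_lambda _ fun i => ?_
    rcases i with i | ⟨j, k⟩ <;> simp only [Sum.elim_inl, Sum.elim_inr] <;> fun_prop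
  have hprob : ∀ i, IsProbabilityMeasure
      (Sum.elim (fun _ : ι₁ => P) (fun _ : ι₂ × ι₃ => Q) i) := by
    rintro (i | i) <;> simpa using by infer_instance
  refine ⟨hmeas, (Measure.pi_eq fun s hs => ?_).symm⟩
  rw [Measure.map_apply hmeas (MeasurableSet.univ_pi hs)]
  have hpre : (fun (p : (ι₁ → X) × (ι₂ → ι₃ → X)) =>
      Sum.elim p.1 fun jk : ι₂ × ι₃ => p.2 jk.1 jk.2) ⁻¹' Set.univ.pi s
      = (Set.univ.pi fun i => s (Sum.inl i)) ×ˢ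
        Set.univ.pi fun j => Set.univ.pi fun k => s (Sum.inr (j, k)) := by
    ext p
    simp [Set.mem_pi]
  rw [hpre, Measure.prod_prod, Measure.pi_pi, Measure.pi_pi, Fintype.prod_sum_type,
    Fintype.prod_prod_type]
  simp only [Measure.pi_pi, Sum.elim_inl, Sum.elim_inr]

/-- Re-weighted multi-label contrastive lower bound on the KL divergence: the
expectation is over `x_1, …, x_n` i.i.d. from `P` and, independently, `n(m-1)`
samples `y_{j,k}` i.i.d. from `Q`. -/
theorem stmt2 {X : Type*} [MeasurableSpace X] (P Q : Measure X)
    [IsProbabilityMeasure P] [IsProbabilityMeasure Q] (hPQ : P ≪ Q)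
    (r : X → ℝ) (hr : Measurable r) (hrpos : ∀ x, 0 < r x)
    (n m : ℕ) (hn : 1 ≤ n) (hm : 2 ≤ m)
    (α : ℝ) (hα_lb : (m : ℝ) / ((n : ℝ) * ((m : ℝ) - 1) + 1) ≤ α) (hα_ub : α ≤ 1) :
    ((∫ p : (Fin n → X) × (Fin n → Fin (m - 1) → X),
        (1 / (n : ℝ)) * ∑ i : Fin n,
          Real.log ((m : ℝ) * (n : ℝ) * r (p.1 i) /
            (α * ∑ j : Fin n, r (p.1 j)
              + (((m : ℝ) - α) / ((m : ℝ) - 1)) * ∑ j : Fin n, ∑ k : Fin (m - 1), r (p.2 j k)))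
        ∂((Measure.pi fun _ : Fin n => P).prod
            (Measure.pi fun _ : Fin n => Measure.pi fun _ : Fin (m - 1) => Q)) : ℝ) : EReal)
      ≤ klDiv P Q := by
  unfold klDiv
  split_ifs with hllr
  swap
  · exact le_top
  rw [EReal.coe_le_coe_iff]
  have hm1 : ((m - 1 : ℕ) : ℝ) = (m : ℝ) - 1 := by rw [Nat.cast_sub (by omega), Nat.cast_one]
  have hmpos : (0 : ℝ) < (m : ℝ) - 1 := by
    have : (2 : ℝ) ≤ m := by exact_mod_cast hm
    linarith
  have hnpos : (0 : ℝ) < n := by exact_mod_cast hn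
  have : NeZero n := ⟨by omega⟩
  have : NeZero (m - 1) := ⟨by omega⟩
  let κ : Fin n ⊕ (Fin n × Fin (m - 1)) → Measure X := Sum.elim (fun _ => P) fun _ => Q
  have hκ : ∀ i, IsProbabilityMeasure (κ i) := by
    rintro (i | i) <;> simpa [κ] using by infer_instance
  let A : Finset (Fin n ⊕ (Fin n × Fin (m - 1))) := Finset.univ.map Function.Embedding.inl
  let B : Finset (Fin n ⊕ (Fin n × Fin (m - 1))) := Finset.univ.map Function.Embedding.inr
  have hAcard : A.card = n := by simp [A]
  have hBcard : (B.card : ℝ) = n * ((m : ℝ) - 1) := by simp [B, hm1]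
  have hbound := integral_mean_log_reweighted_le κ P Q hPQ hllr.2 hr hrpos (A := A) (B := B)
    (by simp [A]) (by simp [B]) (by simp [A, B, Finset.disjoint_left])
    (by simp [A, κ]) (by simp [B, κ]) (α := α) (N := m * n)
    (by rw [hAcard, hBcard]; ring)
    (by
      rw [hAcard, hBcard]
      refine le_trans (le_of_eq ?_) hα_lb
      have : (n : ℝ) * (m - 1) + 1 ≠ 0 := by positivity
      field_simp) hα_ub
  have hmp := measurePreserving_sumElim_uncurry (ι₁ := Fin n) (ι₂ := Fin n) (ι₃ := Fin (m - 1)) P Q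
  change ∫ z, _ ∂(Measure.pi (Sum.elim (fun _ => P) fun _ => Q)) ≤ _ at hbound
  rw [← hmp.map_eq, integral_map hmp.aemeasurable
    (Measurable.aestronglyMeasurable (by fun_prop))] at hbound
  refine le_trans (le_of_eq (integral_congr_ae (ae_of_all _ fun p => ?_))) hbound
  have hcoef : ((m : ℝ) * n - α * n) / (n * (m - 1)) = (m - α) / (m - 1) := by
    field_simp
  simp only [hAcard, hBcard, hcoef, A, B, Finset.sum_map, Function.Embedding.inl_apply,
    Function.Embedding.inr_apply, Sum.elim_inl, Sum.elim_inr, Fintype.sum_prod_type]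
end

section
/- Let X and Y be random variables with joint law p(x,y) on 𝒳 × 𝒴, such that p(x,y) is absolutely continuous with respect to the product p(x)p(y) of its marginals. For every integer n ≥ 1 and integer m ≥ 2, define α_{m,n} = m/(n(m−1)+1). Then for every real α with α_{m,n} ≤ α ≤ 1 and every measurable critic g : 𝒳 × 𝒴 → ℝ with g > 0 everywhere, the re-weighted multi-label CPC objective satisfies J_α(g) ≤ I(X; Y). -/
open MeasureTheory Real
open scoped Classical

open Set Filter Topology
open scoped ENNReal

/-- `f` is a nonincreasing function on `[0, ∞)` with values in `[0, 1]`, tending to `0` at infinity,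
whose derivative `f'` on `(0, ∞)` is bounded by `c / s`, as are Laplace transforms of laws on
`(0, ∞)`. -/
structure IsDecay (c : ℝ) (f f' : ℝ → ℝ) : Prop where
  nonneg : ∀ s, 0 ≤ s → 0 ≤ f s
  le_one : ∀ s, 0 ≤ s → f s ≤ 1
  cont : ContinuousWithinAt f (Ici 0) 0
  lim : Tendsto f atTop (𝓝 0)
  deriv : ∀ s, 0 < s → HasDerivAt f (f' s) s
  deriv_nonpos : ∀ s, 0 < s → f' s ≤ 0
  le_deriv : ∀ s, 0 < s → -(c / s) ≤ f' s

lemma IsDecay.exp {a : ℝ} (ha : 0 < a) :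
    IsDecay 1 (fun s => Real.exp (-(s * a))) (fun s => -(a * Real.exp (-(s * a)))) where
  nonneg s _ := (Real.exp_pos _).le
  le_one s hs := by
    rw [Real.exp_le_one_iff]
    have := mul_nonneg hs ha.le
    linarith
  cont := by fun_prop
  lim := by
    refine Real.tendsto_exp_atBot.comp (tendsto_neg_atTop_atBot.comp ?_)
    exact tendsto_id.atTop_mul_const ha
  deriv s _ := by
    have h : HasDerivAt (fun s : ℝ => -(s * a)) (-(1 * a)) s :=
      ((hasDerivAt_id s).mul_const a).neg
    convert h.exp using 1
    ring
  deriv_nonpos s _ := by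
    have := mul_pos ha (Real.exp_pos (-(s * a)))
    linarith
  le_deriv s hs := by
    have h1 : s * a * Real.exp (-(s * a)) ≤ 1 := by
      rw [Real.exp_neg, ← div_eq_mul_inv, div_le_one (Real.exp_pos _)]
      linarith [Real.add_one_le_exp (s * a)]
    rw [neg_le_neg_iff, le_div_iff₀ hs]
    linarith

lemma IsDecay.pow {c : ℝ} {f f' : ℝ → ℝ} (h : IsDecay c f f') {m : ℕ} (hm : m ≠ 0) :
    IsDecay (m * c) (fun s => f s ^ m) (fun s => m * f s ^ (m - 1) * f' s) where
  nonneg s hs := pow_nonneg (h.nonneg s hs) m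
  le_one s hs := pow_le_one₀ (h.nonneg s hs) (h.le_one s hs)
  cont := h.cont.pow m
  lim := by simpa [hm] using h.lim.pow m
  deriv s hs := (h.deriv s hs).pow m
  deriv_nonpos s hs := mul_nonpos_of_nonneg_of_nonpos
    (mul_nonneg m.cast_nonneg (pow_nonneg (h.nonneg s hs.le) _)) (h.deriv_nonpos s hs)
  le_deriv s hs := by
    have h1 := h.le_deriv s hs
    have h2 := h.deriv_nonpos s hs
    have h3 : f s ^ (m - 1) ≤ 1 := pow_le_one₀ (h.nonneg s hs.le) (h.le_one s hs.le)
    have h4 : 0 ≤ f s ^ (m - 1) := pow_nonneg (h.nonneg s hs.le) _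
    have h5 : -(c / s) ≤ f s ^ (m - 1) * f' s := by nlinarith
    have h6 := mul_le_mul_of_nonneg_left h5 (m.cast_nonneg (α := ℝ))
    calc -(m * c / s) = m * -(c / s) := by ring
      _ ≤ _ := by rw [mul_assoc]; exact h6

lemma IsDecay.integral {X : Type*} [MeasurableSpace X] (P : Measure X) [IsProbabilityMeasure P]
    {c : ℝ} (hc : 0 ≤ c) {u u' : X → ℝ → ℝ} (h : ∀ x, IsDecay c (u x) (u' x))
    (hu : ∀ s, Measurable fun x => u x s) (hu' : ∀ s, Measurable fun x => u' x s) :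
    IsDecay c (fun s => ∫ x, u x s ∂P) (fun s => ∫ x, u' x s ∂P) where
  nonneg s hs := integral_nonneg fun x => (h x).nonneg s hs
  le_one s hs := by
    calc ∫ x, u x s ∂P ≤ ∫ _, (1 : ℝ) ∂P :=
          integral_mono_of_nonneg (ae_of_all _ fun x => (h x).nonneg s hs) (integrable_const _)
            (ae_of_all _ fun x => (h x).le_one s hs)
      _ = 1 := by simp
  cont := by
    refine continuousWithinAt_of_dominated (bound := fun _ => 1)
      (Eventually.of_forall fun s => (hu s).aestronglyMeasurable) ?_ (integrable_const _)
      (ae_of_all _ fun x => (h x).cont)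
    filter_upwards [self_mem_nhdsWithin] with s hs
    refine ae_of_all _ fun x => ?_
    rw [Real.norm_of_nonneg ((h x).nonneg s hs)]
    exact (h x).le_one s hs
  lim := by
    have := tendsto_integral_filter_of_dominated_convergence (μ := P) (l := atTop)
      (F := fun s x => u x s) (f := fun _ => 0) (fun _ => 1)
      (Eventually.of_forall fun s => (hu s).aestronglyMeasurable) ?_ (integrable_const _)
      (ae_of_all _ fun x => (h x).lim)
    · simpa using this
    filter_upwards [eventually_ge_atTop 0] with s hs
    refine ae_of_all _ fun x => ?_
    rw [Real.norm_of_nonneg ((h x).nonneg s hs)]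
    exact (h x).le_one s hs
  deriv s hs := by
    refine (hasDerivAt_integral_of_dominated_loc_of_deriv_le (bound := fun _ => c / (s / 2))
      (F := fun s x => u x s) (F' := fun s x => u' x s)
      (Ioi_mem_nhds (half_lt_self hs)) (Eventually.of_forall fun s => (hu s).aestronglyMeasurable)
      ?_ (hu' s).aestronglyMeasurable ?_ (integrable_const _) ?_).2
    · refine Integrable.of_bound (hu s).aestronglyMeasurable 1 (ae_of_all _ fun x => ?_)
      rw [Real.norm_of_nonneg ((h x).nonneg s hs.le)]
      exact (h x).le_one s hs.le
    · refine ae_of_all _ fun x t ht => ?_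
      have ht' : s / 2 < t := ht
      have h0 : 0 < t := (half_pos hs).trans ht'
      rw [Real.norm_of_nonpos ((h x).deriv_nonpos t h0)]
      have h1 := (h x).le_deriv t h0
      have h2 : c / t ≤ c / (s / 2) := div_le_div_of_nonneg_left hc (half_pos hs) ht'.le
      linarith
    · exact ae_of_all _ fun x t ht => (h x).deriv t ((half_pos hs).trans ht)
  deriv_nonpos s hs := integral_nonpos fun x => (h x).deriv_nonpos s hs
  le_deriv s hs := by
    have h1 : ∫ x, -u' x s ∂P ≤ ∫ _, c / s ∂P :=
      integral_mono_of_nonneg (ae_of_all _ fun x => neg_nonneg.2 ((h x).deriv_nonpos s hs))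
        (integrable_const _) (ae_of_all _ fun x => by
          show -u' x s ≤ c / s
          linarith [(h x).le_deriv s hs])
    rw [integral_neg] at h1
    simp at h1
    linarith

/-- `∫₀^∞ (-C') C^p ≤ 1 / (p + 1)` for `C` nonincreasing with values in `[0, 1]`. -/
lemma IsDecay.lintegral_rpow_mul_neg_deriv_le {c : ℝ} {C C' : ℝ → ℝ} (h : IsDecay c C C') {p : ℝ}
    (hp : 0 ≤ p) :
    ∫⁻ s in Ioi (0 : ℝ), ENNReal.ofReal (-C' s * C s ^ p) ≤ ENNReal.ofReal (1 / (p + 1)) := by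
  have hp1 : 0 < p + 1 := by linarith
  set G : ℝ → ℝ := fun s => C s ^ (p + 1) / (p + 1) with hG
  have hcont : ContinuousWithinAt G (Ici 0) 0 :=
    (h.cont.rpow_const (Or.inr hp1.le)).div_const _
  have hder : ∀ s ∈ Ioi (0 : ℝ), HasDerivAt G (C' s * C s ^ p) s := by
    intro s hs
    have := ((h.deriv s hs).rpow_const (p := p + 1) (Or.inr (by linarith))).div_const (p + 1)
    have h2 : C' s * (p + 1) * C s ^ (p + 1 - 1) / (p + 1) = C' s * C s ^ p := by
      rw [add_sub_cancel_right]
      field_simp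
    rwa [h2] at this
  have hneg : ∀ s ∈ Ioi (0 : ℝ), C' s * C s ^ p ≤ 0 := fun s hs =>
    mul_nonpos_of_nonpos_of_nonneg (h.deriv_nonpos s hs)
      (Real.rpow_nonneg (h.nonneg s (le_of_lt hs)) _)
  have hlim : Tendsto G atTop (𝓝 0) := by
    have := (h.lim.rpow_const (p := p + 1) (Or.inr hp1.le)).div_const (p + 1)
    simpa [Real.zero_rpow hp1.ne'] using this
  have hint := integrableOn_Ioi_deriv_of_nonpos hcont hder hneg hlim
  have hval := integral_Ioi_of_hasDerivAt_of_nonpos hcont hder hneg hlim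
  have hint' : IntegrableOn (fun s => -C' s * C s ^ p) (Ioi 0) := by
    refine hint.neg.congr (ae_of_all _ fun s => ?_)
    simp
  rw [← ofReal_integral_eq_lintegral_ofReal hint']
  · refine ENNReal.ofReal_le_ofReal ?_
    have : ∫ s in Ioi (0 : ℝ), -C' s * C s ^ p = G 0 := by
      simp only [neg_mul]
      rw [integral_neg, hval]
      ring
    rw [this]
    exact div_le_div_of_nonneg_right
      (Real.rpow_le_one (h.nonneg 0 le_rfl) (h.le_one 0 le_rfl) hp1.le) hp1.le
  · filter_upwards [self_mem_ae_restrict measurableSet_Ioi] with s hs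
    have := hneg s hs
    show 0 ≤ -C' s * C s ^ p
    linarith

lemma lintegral_pi_prod {ι : Type*} [Fintype ι] {X : Type*} [MeasurableSpace X] (P : Measure X)
    [IsProbabilityMeasure P] (f : ι → X → ℝ≥0∞) (hf : ∀ i, Measurable (f i)) :
    ∫⁻ x, ∏ i, f i (x i) ∂(Measure.pi fun _ : ι => P) = ∏ i, ∫⁻ x, f i x ∂P := by
  have hi : ProbabilityTheory.iIndepFun (fun (i : ι) (x : ι → X) => f i (x i))
      (Measure.pi fun _ : ι => P) :=
    ProbabilityTheory.iIndepFun_pi fun i => (hf i).aemeasurable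
  rw [ProbabilityTheory.lintegral_prod_eq_prod_lintegral_of_indepFun _ _ hi
    fun i => (hf i).comp (measurable_pi_apply i)]
  refine Finset.prod_congr rfl fun i _ => ?_
  exact (measurePreserving_eval (fun _ : ι => P) i).lintegral_comp (hf i)

/-- Importance weights: `exp (-llr μ q)` turns integrals against `μ` into integrals against `q`. -/
lemma lintegral_exp_neg_llr_mul_le_s3 {X : Type*} [MeasurableSpace X] (μ q : Measure X)
    [SigmaFinite μ] [SigmaFinite q] (hac : μ ≪ q) (H : X → ℝ≥0∞) (hH : Measurable H) :
    ∫⁻ z, ENNReal.ofReal (Real.exp (-llr μ q z)) * H z ∂μ ≤ ∫⁻ z, H z ∂q := by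
  calc ∫⁻ z, ENNReal.ofReal (Real.exp (-llr μ q z)) * H z ∂μ
      = ∫⁻ z, (q.rnDeriv μ * H) z ∂μ := by
        refine lintegral_congr_ae ?_
        filter_upwards [exp_neg_llr hac, q.rnDeriv_lt_top μ] with z hz hz'
        rw [hz, ENNReal.ofReal_toReal hz'.ne, Pi.mul_apply]
    _ = ∫⁻ z, H z ∂(μ.withDensity (q.rnDeriv μ)) :=
        (lintegral_withDensity_eq_lintegral_mul μ (q.measurable_rnDeriv μ) hH).symm
    _ ≤ _ := lintegral_mono' (Measure.withDensity_rnDeriv_le _ _) le_rfl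

lemma ofReal_div_eq_lintegral {a b : ℝ} (ha : 0 ≤ a) (hb : 0 < b) :
    ENNReal.ofReal (a / b) = ∫⁻ s in Ioi (0 : ℝ), ENNReal.ofReal (a * Real.exp (-(s * b))) := by
  have h1 : IntegrableOn (fun s : ℝ => a * Real.exp (-(s * b))) (Ioi 0) := by
    have := (integrableOn_exp_mul_Ioi (a := -b) (by linarith) 0).const_mul a
    refine this.congr (ae_of_all _ fun s => ?_)
    simp only []
    ring_nf
  rw [← ofReal_integral_eq_lintegral_ofReal h1
    (ae_of_all _ fun s => mul_nonneg ha (Real.exp_pos _).le), integral_const_mul]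
  have h2 := integral_exp_mul_Ioi (a := -b) (by linarith) 0
  have h3 : ∫ s in Ioi (0 : ℝ), Real.exp (-(s * b)) = 1 / b := by
    have : ∀ s : ℝ, -(s * b) = -b * s := fun s => by ring
    simp only [this, h2]
    simp [neg_div_neg_eq]
  rw [h3, mul_one_div]

/-- Lyapunov's inequality between consecutive moments of a `[0, 1]`-valued function. -/
lemma integral_pow_le_rpow {X : Type*} [MeasurableSpace X] (P : Measure X) [IsProbabilityMeasure P]
    (f : X → ℝ) (hf : Measurable f) (h0 : ∀ x, 0 ≤ f x) (h1 : ∀ x, f x ≤ 1) {m : ℕ} (hm : 2 ≤ m) :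
    ∫ x, f x ^ (m - 1) ∂P ≤ (∫ x, f x ^ m ∂P) ^ (((m : ℝ) - 1) / m) := by
  have hm' : (2 : ℝ) ≤ m := by exact_mod_cast hm
  set r : ℝ := (m : ℝ) / (m - 1) with hr
  have hr1 : 1 ≤ r := by rw [hr, one_le_div (by linarith)]; linarith
  have hint : ∀ k : ℕ, Integrable (fun x => f x ^ k) P := fun k =>
    Integrable.of_bound (hf.pow_const k).aestronglyMeasurable 1 (ae_of_all _ fun x => by
      rw [Real.norm_of_nonneg (pow_nonneg (h0 x) k)]
      exact pow_le_one₀ (h0 x) (h1 x))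
  have hpow : ∀ x, (f x ^ (m - 1)) ^ r = f x ^ m := by
    intro x
    rw [← Real.rpow_natCast, ← Real.rpow_mul (h0 x), Nat.cast_sub (by omega), Nat.cast_one, hr,
      mul_div_cancel₀ _ (by linarith), Real.rpow_natCast]
  have hJ := (convexOn_rpow hr1).map_integral_le (μ := P) (f := fun x => f x ^ (m - 1))
    (continuousOn_id.rpow_const fun x _ => Or.inr (by linarith)) isClosed_Ici
    (ae_of_all _ fun x => pow_nonneg (h0 x) _) (hint _) (by
      simpa only [Function.comp_def, hpow] using hint m)
  simp only [hpow] at hJ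
  have hA : 0 ≤ ∫ x, f x ^ (m - 1) ∂P := integral_nonneg fun x => pow_nonneg (h0 x) _
  calc ∫ x, f x ^ (m - 1) ∂P = ((∫ x, f x ^ (m - 1) ∂P) ^ r) ^ (((m : ℝ) - 1) / m) := by
        rw [← Real.rpow_mul hA]
        have : r * (((m : ℝ) - 1) / m) = 1 := by
          have : (m : ℝ) - 1 ≠ 0 := by linarith
          rw [hr]
          field_simp
        rw [this, Real.rpow_one]
    _ ≤ _ := by
        refine Real.rpow_le_rpow (Real.rpow_nonneg hA _) hJ ?_
        exact div_nonneg (by linarith) (by linarith)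

/-- Fubini for a function of the positive pair `i` times a product over the negatives in `J`. -/
lemma lintegral_mul_prod_negatives {𝒳 𝒴 : Type*} [MeasurableSpace 𝒳] [MeasurableSpace 𝒴]
    (μ : Measure (𝒳 × 𝒴)) [IsProbabilityMeasure μ] (ν : Measure 𝒴) [IsProbabilityMeasure ν]
    {n l : ℕ} (J : Finset (Fin n)) {i : Fin n} (hi : i ∈ J) (K : 𝒳 × 𝒴 → ℝ≥0∞) (hK : Measurable K)
    (e : 𝒳 × 𝒴 → ℝ≥0∞) (he : Measurable e) :
    ∫⁻ p : (Fin n → 𝒳 × 𝒴) × (Fin n → Fin l → 𝒴),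
        K (p.1 i) * ∏ j ∈ J, ∏ k, e ((p.1 j).1, p.2 j k)
        ∂((Measure.pi fun _ : Fin n => μ).prod
            (Measure.pi fun _ : Fin n => Measure.pi fun _ : Fin l => ν))
      = (∫⁻ z, K z * (∫⁻ y, e (z.1, y) ∂ν) ^ l ∂μ)
        * (∫⁻ z, (∫⁻ y, e (z.1, y) ∂ν) ^ l ∂μ) ^ (J.card - 1) := by
  have hΨ : Measurable fun z : 𝒳 × 𝒴 => (∫⁻ y, e (z.1, y) ∂ν) ^ l :=
    (he.lintegral_prod_right'.comp measurable_fst).pow_const l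
  have hmeas : Measurable fun p : (Fin n → 𝒳 × 𝒴) × (Fin n → Fin l → 𝒴) =>
      K (p.1 i) * ∏ j ∈ J, ∏ k, e ((p.1 j).1, p.2 j k) := by
    fun_prop
  rw [lintegral_prod _ hmeas.aemeasurable]
  have hinner : ∀ z : Fin n → 𝒳 × 𝒴,
      ∫⁻ y : Fin n → Fin l → 𝒴, K (z i) * ∏ j ∈ J, ∏ k, e ((z j).1, y j k)
        ∂(Measure.pi fun _ : Fin n => Measure.pi fun _ : Fin l => ν)
      = ∏ j, ((if j = i then K (z j) else 1)
          * (if j ∈ J then (∫⁻ y, e ((z j).1, y) ∂ν) ^ l else 1)) := by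
    intro z
    rw [lintegral_const_mul _ (by fun_prop), Finset.prod_mul_distrib, Finset.prod_ite_eq',
      if_pos (Finset.mem_univ i)]
    congr 1
    have h1 : ∀ y : Fin n → Fin l → 𝒴, ∏ j ∈ J, ∏ k, e ((z j).1, y j k)
        = ∏ j, (fun (j : Fin n) (w : Fin l → 𝒴) =>
            if j ∈ J then ∏ k, e ((z j).1, w k) else 1) j (y j) := by
      intro y
      simp only [Finset.prod_ite_mem, Finset.univ_inter]
    simp only [h1]
    rw [lintegral_pi_prod _ (fun (j : Fin n) (w : Fin l → 𝒴) =>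
            if j ∈ J then ∏ k, e ((z j).1, w k) else 1)]
    · refine Finset.prod_congr rfl fun j _ => ?_
      by_cases hj : j ∈ J
      · simp only [hj, if_true]
        rw [lintegral_pi_prod ν (fun (_ : Fin l) (y : 𝒴) => e ((z j).1, y)) fun _ => by fun_prop]
        simp
      · simp [hj]
    · intro j
      by_cases hj : j ∈ J
      · simp only [hj, if_true]
        fun_prop
      · simp [hj]
  simp only [hinner]
  rw [lintegral_pi_prod μ (fun (j : Fin n) (z : 𝒳 × 𝒴) => (if j = i then K z else 1)
          * (if j ∈ J then (∫⁻ y, e (z.1, y) ∂ν) ^ l else 1))]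
  · rw [← Finset.mul_prod_erase _ _ (Finset.mem_univ i)]
    simp only [if_true, hi]
    congr 1
    rw [← Finset.card_erase_of_mem hi, ← Finset.prod_const]
    have : ∀ j ∈ Finset.univ.erase i,
        ∫⁻ z, ((if j = i then K z else 1)
          * (if j ∈ J then (∫⁻ y, e (z.1, y) ∂ν) ^ l else 1)) ∂μ
        = if j ∈ J.erase i then ∫⁻ z, (∫⁻ y, e (z.1, y) ∂ν) ^ l ∂μ else 1 := by
      intro j hj
      have hji := Finset.ne_of_mem_erase hj
      by_cases hJ : j ∈ J <;> simp [hji, hJ]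
    rw [Finset.prod_congr rfl this, Finset.prod_ite_mem]
    congr 1
    ext j
    simp
  · intro j
    refine Measurable.mul ?_ ?_
    · by_cases h : j = i <;> simp [h, hK]
    · by_cases h : j ∈ J <;> simp [h, hΨ]

/-- Under importance weighting, a positive score normalized by itself and the negatives of the rows
in `J` has mean at most `1 / (|J| (m - 1) + 1)`. -/
lemma lintegral_weighted_ratio_le {𝒳 𝒴 : Type*} [MeasurableSpace 𝒳] [MeasurableSpace 𝒴]
    (μ : Measure (𝒳 × 𝒴)) [IsProbabilityMeasure μ]
    (hac : μ ≪ (μ.map Prod.fst).prod (μ.map Prod.snd)) {n m : ℕ} (hm : 2 ≤ m)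
    (g : 𝒳 × 𝒴 → ℝ) (hg : Measurable g) (hgpos : ∀ p, 0 < g p)
    (J : Finset (Fin n)) {i : Fin n} (hi : i ∈ J) :
    ∫⁻ p : (Fin n → 𝒳 × 𝒴) × (Fin n → Fin (m - 1) → 𝒴),
        ENNReal.ofReal (Real.exp (-llr μ ((μ.map Prod.fst).prod (μ.map Prod.snd)) (p.1 i))
          * g (p.1 i) / (g (p.1 i) + ∑ j ∈ J, ∑ k, g ((p.1 j).1, p.2 j k)))
        ∂((Measure.pi fun _ : Fin n => μ).prod
            (Measure.pi fun _ : Fin n => Measure.pi fun _ : Fin (m - 1) => μ.map Prod.snd))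
      ≤ ENNReal.ofReal (1 / (J.card * ((m : ℝ) - 1) + 1)) := by
  have hm' : (2 : ℝ) ≤ m := by exact_mod_cast hm
  have hm0 : (m : ℝ) ≠ 0 := by linarith
  have hJ : 1 ≤ J.card := Finset.card_pos.2 ⟨i, hi⟩
  have : IsProbabilityMeasure (μ.map Prod.fst) :=
    Measure.isProbabilityMeasure_map measurable_fst.aemeasurable
  have : IsProbabilityMeasure (μ.map Prod.snd) :=
    Measure.isProbabilityMeasure_map measurable_snd.aemeasurable
  set P := μ.map Prod.fst with hP
  set ν := μ.map Prod.snd with hν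
  set q := P.prod ν with hq
  have hllr : Measurable (llr μ q) := measurable_llr μ q
  set Φ : 𝒳 → ℝ → ℝ := fun x s => ∫ y, Real.exp (-(s * g (x, y))) ∂ν with hΦdef
  set Φ' : 𝒳 → ℝ → ℝ := fun x s => ∫ y, -(g (x, y) * Real.exp (-(s * g (x, y)))) ∂ν with hΦ'def
  have hΦ : ∀ x, IsDecay 1 (Φ x) (Φ' x) := fun x =>
    IsDecay.integral ν zero_le_one (fun y => IsDecay.exp (hgpos (x, y)))
      (fun s => by fun_prop) (fun s => by fun_prop)
  have mΦ : ∀ s, Measurable fun x => Φ x s := fun s => by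
    have : Measurable fun z : 𝒳 × 𝒴 => Real.exp (-(s * g z)) := by fun_prop
    exact this.stronglyMeasurable.integral_prod_right'.measurable
  have mΦ' : ∀ s, Measurable fun x => Φ' x s := fun s => by
    have : Measurable fun z : 𝒳 × 𝒴 => -(g z * Real.exp (-(s * g z))) := by fun_prop
    exact this.stronglyMeasurable.integral_prod_right'.measurable
  set C : ℝ → ℝ := fun s => ∫ x, Φ x s ^ m ∂P with hCdef
  set C' : ℝ → ℝ := fun s => ∫ x, m * Φ x s ^ (m - 1) * Φ' x s ∂P with hC'def
  have hC : IsDecay (m * 1) C C' :=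
    IsDecay.integral P (by linarith) (fun x => (hΦ x).pow (m := m) (by omega))
      (fun s => (mΦ s).pow_const m) (fun s => by have := mΦ s; have := mΦ' s; fun_prop)
  -- the Laplace transform in terms of extended nonnegative integrals
  have hΨ : ∀ s, 0 < s → ∀ x,
      ∫⁻ y, ENNReal.ofReal (Real.exp (-(s * g (x, y)))) ∂ν = ENNReal.ofReal (Φ x s) := by
    intro s hs x
    refine (ofReal_integral_eq_lintegral_ofReal ?_
      (ae_of_all _ fun y => (Real.exp_pos _).le)).symm
    refine Integrable.of_bound (Measurable.aestronglyMeasurable (by fun_prop)) 1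
      (ae_of_all _ fun y => ?_)
    rw [Real.norm_of_nonneg (Real.exp_pos _).le]
    exact (IsDecay.exp (hgpos (x, y))).le_one s hs.le
  have hΨ' : ∀ s, 0 < s → ∀ x,
      ∫⁻ y, ENNReal.ofReal (g (x, y) * Real.exp (-(s * g (x, y)))) ∂ν
        = ENNReal.ofReal (-Φ' x s) := by
    intro s hs x
    rw [hΦ'def]
    simp only []
    rw [integral_neg, neg_neg]
    refine (ofReal_integral_eq_lintegral_ofReal ?_
      (ae_of_all _ fun y => mul_nonneg (hgpos _).le (Real.exp_pos _).le)).symm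
    refine Integrable.of_bound (by fun_prop) (1 / s) (ae_of_all _ fun y => ?_)
    rw [Real.norm_of_nonneg (mul_nonneg (hgpos _).le (Real.exp_pos _).le)]
    exact neg_le_neg_iff.1 ((IsDecay.exp (hgpos (x, y))).le_deriv s hs)
  have hB : ∀ s, 0 < s →
      ∫⁻ z, (∫⁻ y, ENNReal.ofReal (Real.exp (-(s * g (z.1, y)))) ∂ν) ^ (m - 1) ∂μ
        ≤ ENNReal.ofReal (C s ^ (((m : ℝ) - 1) / m)) := by
    intro s hs
    have hpos : ∀ x, 0 ≤ Φ x s := fun x => (hΦ x).nonneg s hs.le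
    have hle : ∀ x, Φ x s ≤ 1 := fun x => (hΦ x).le_one s hs.le
    simp only [hΨ s hs]
    have h1 : ∫⁻ z : 𝒳 × 𝒴, ENNReal.ofReal (Φ z.1 s) ^ (m - 1) ∂μ
        = ∫⁻ x, ENNReal.ofReal (Φ x s ^ (m - 1)) ∂P := by
      rw [hP, lintegral_map ((mΦ s).pow_const _).ennreal_ofReal measurable_fst]
      simp only [ENNReal.ofReal_pow (hpos _)]
    rw [h1, ← ofReal_integral_eq_lintegral_ofReal]
    · exact ENNReal.ofReal_le_ofReal (integral_pow_le_rpow P _ (mΦ s) hpos hle hm)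
    · refine Integrable.of_bound ((mΦ s).pow_const _).aestronglyMeasurable 1
        (ae_of_all _ fun x => ?_)
      rw [Real.norm_of_nonneg (pow_nonneg (hpos x) _)]
      exact pow_le_one₀ (hpos x) (hle x)
    · exact ae_of_all _ fun x => pow_nonneg (hpos x) _
  have hA : ∀ s, 0 < s →
      ∫⁻ z, ENNReal.ofReal (Real.exp (-llr μ q z) * g z * Real.exp (-(s * g z)))
          * (∫⁻ y, ENNReal.ofReal (Real.exp (-(s * g (z.1, y)))) ∂ν) ^ (m - 1) ∂μ
        ≤ ENNReal.ofReal (-C' s / m) := by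
    intro s hs
    have hpos : ∀ x, 0 ≤ Φ x s := fun x => (hΦ x).nonneg s hs.le
    have hle : ∀ x, Φ x s ≤ 1 := fun x => (hΦ x).le_one s hs.le
    have mp := mΦ s
    simp only [hΨ s hs]
    calc ∫⁻ z, ENNReal.ofReal (Real.exp (-llr μ q z) * g z * Real.exp (-(s * g z)))
          * ENNReal.ofReal (Φ z.1 s) ^ (m - 1) ∂μ
        = ∫⁻ z, ENNReal.ofReal (Real.exp (-llr μ q z))
            * (ENNReal.ofReal (g z * Real.exp (-(s * g z)))
              * ENNReal.ofReal (Φ z.1 s) ^ (m - 1)) ∂μ := by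
          refine lintegral_congr fun z => ?_
          rw [mul_assoc (Real.exp _), ENNReal.ofReal_mul (Real.exp_pos _).le, mul_assoc]
      _ ≤ ∫⁻ z, ENNReal.ofReal (g z * Real.exp (-(s * g z)))
              * ENNReal.ofReal (Φ z.1 s) ^ (m - 1) ∂q :=
          lintegral_exp_neg_llr_mul_le_s3 μ q hac _ (by fun_prop)
      _ = ∫⁻ x, ENNReal.ofReal (-Φ' x s * Φ x s ^ (m - 1)) ∂P := by
          rw [hq, lintegral_prod _ (by fun_prop)]
          refine lintegral_congr fun x => ?_
          simp only []
          rw [lintegral_mul_const _ (by fun_prop), hΨ' s hs,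
            ENNReal.ofReal_mul (neg_nonneg.2 ((hΦ x).deriv_nonpos s hs)),
            ENNReal.ofReal_pow (hpos x)]
      _ = ENNReal.ofReal (∫ x, -Φ' x s * Φ x s ^ (m - 1) ∂P) := by
          symm
          refine ofReal_integral_eq_lintegral_ofReal ?_ (ae_of_all _ fun x =>
            mul_nonneg (neg_nonneg.2 ((hΦ x).deriv_nonpos s hs)) (pow_nonneg (hpos x) _))
          have mp' := mΦ' s
          refine Integrable.of_bound (by fun_prop) (1 / s) (ae_of_all _ fun x => ?_)
          have h1 := (hΦ x).deriv_nonpos s hs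
          have h2 := (hΦ x).le_deriv s hs
          have h3 := pow_nonneg (hpos x) (m - 1)
          rw [Real.norm_of_nonneg (mul_nonneg (by linarith) h3)]
          have h4 : Φ x s ^ (m - 1) ≤ 1 := pow_le_one₀ (hpos x) (hle x)
          nlinarith
      _ = ENNReal.ofReal (-C' s / m) := by
          congr 1
          rw [hC'def]
          simp only []
          rw [← integral_neg, ← integral_div]
          refine integral_congr_ae (ae_of_all _ fun x => ?_)
          simp only []
          field_simp
  -- the exponent produced by the remaining rows
  set r : ℝ := ((m : ℝ) - 1) / m * ((J.card - 1 : ℕ) : ℝ) with hr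
  have hr0 : 0 ≤ r := mul_nonneg (div_nonneg (by linarith) (by linarith)) (Nat.cast_nonneg _)
  have hmr : 1 / (m : ℝ) * (1 / (r + 1)) = 1 / (J.card * ((m : ℝ) - 1) + 1) := by
    rw [hr, Nat.cast_sub hJ, Nat.cast_one, one_div_mul_one_div]
    congr 1
    field_simp
    ring
  have hslice : ∀ s ∈ Ioi (0 : ℝ),
      ∫⁻ p : (Fin n → 𝒳 × 𝒴) × (Fin n → Fin (m - 1) → 𝒴),
        ENNReal.ofReal (Real.exp (-llr μ q (p.1 i)) * g (p.1 i)
          * Real.exp (-(s * (g (p.1 i) + ∑ j ∈ J, ∑ k, g ((p.1 j).1, p.2 j k)))))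
        ∂((Measure.pi fun _ : Fin n => μ).prod
            (Measure.pi fun _ : Fin n => Measure.pi fun _ : Fin (m - 1) => ν))
      ≤ ENNReal.ofReal (1 / m) * ENNReal.ofReal (-C' s * C s ^ r) := by
    intro s hs
    have hs : 0 < s := hs
    have hC0 := hC.nonneg s hs.le
    have hsplit : ∀ p : (Fin n → 𝒳 × 𝒴) × (Fin n → Fin (m - 1) → 𝒴),
        ENNReal.ofReal (Real.exp (-llr μ q (p.1 i)) * g (p.1 i)
          * Real.exp (-(s * (g (p.1 i) + ∑ j ∈ J, ∑ k, g ((p.1 j).1, p.2 j k)))))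
        = ENNReal.ofReal (Real.exp (-llr μ q (p.1 i)) * g (p.1 i) * Real.exp (-(s * g (p.1 i))))
          * ∏ j ∈ J, ∏ k, ENNReal.ofReal (Real.exp (-(s * g ((p.1 j).1, p.2 j k)))) := by
      intro p
      have h1 : Real.exp (-(s * (g (p.1 i) + ∑ j ∈ J, ∑ k, g ((p.1 j).1, p.2 j k))))
          = Real.exp (-(s * g (p.1 i)))
            * ∏ j ∈ J, ∏ k, Real.exp (-(s * g ((p.1 j).1, p.2 j k))) := by
        simp only [← Real.exp_sum, ← Real.exp_add, Finset.sum_neg_distrib, ← Finset.mul_sum]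
        congr 1
        ring
      rw [h1, ← mul_assoc, ENNReal.ofReal_mul (mul_nonneg (mul_nonneg (Real.exp_pos _).le
        (hgpos _).le) (Real.exp_pos _).le), ENNReal.ofReal_prod_of_nonneg
        fun j _ => Finset.prod_nonneg fun k _ => (Real.exp_pos _).le]
      congr 1
      exact Finset.prod_congr rfl fun j _ =>
        ENNReal.ofReal_prod_of_nonneg fun k _ => (Real.exp_pos _).le
    simp only [hsplit]
    rw [lintegral_mul_prod_negatives μ ν J hi
      (fun z => ENNReal.ofReal (Real.exp (-llr μ q z) * g z * Real.exp (-(s * g z))))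
      (by fun_prop) (fun z => ENNReal.ofReal (Real.exp (-(s * g z)))) (by fun_prop)]
    refine (mul_le_mul' (hA s hs) (pow_le_pow_left' (hB s hs) _)).trans ?_
    rw [← ENNReal.ofReal_pow (Real.rpow_nonneg hC0 _), ← Real.rpow_natCast, ← Real.rpow_mul hC0,
      ← ENNReal.ofReal_mul (div_nonneg (neg_nonneg.2 (hC.deriv_nonpos s hs)) (by linarith)),
      ← ENNReal.ofReal_mul (by positivity)]
    refine ENNReal.ofReal_le_ofReal (le_of_eq ?_)
    rw [← hr]
    ring
  have hmeas : Measurable fun x : ((Fin n → 𝒳 × 𝒴) × (Fin n → Fin (m - 1) → 𝒴)) × ℝ =>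
      ENNReal.ofReal (Real.exp (-llr μ q (x.1.1 i)) * g (x.1.1 i)
          * Real.exp (-(x.2 * (g (x.1.1 i) + ∑ j ∈ J, ∑ k, g ((x.1.1 j).1, x.1.2 j k))))) := by
    fun_prop
  calc _ = ∫⁻ p : (Fin n → 𝒳 × 𝒴) × (Fin n → Fin (m - 1) → 𝒴), (∫⁻ s in Ioi (0 : ℝ),
        ENNReal.ofReal (Real.exp (-llr μ q (p.1 i)) * g (p.1 i)
          * Real.exp (-(s * (g (p.1 i) + ∑ j ∈ J, ∑ k, g ((p.1 j).1, p.2 j k))))))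
        ∂((Measure.pi fun _ : Fin n => μ).prod
            (Measure.pi fun _ : Fin n => Measure.pi fun _ : Fin (m - 1) => ν)) := by
        refine lintegral_congr fun p => ?_
        exact ofReal_div_eq_lintegral (mul_nonneg (Real.exp_pos _).le (hgpos _).le)
          (add_pos_of_pos_of_nonneg (hgpos _)
            (Finset.sum_nonneg fun j _ => Finset.sum_nonneg fun k _ => (hgpos _).le))
    _ = _ := lintegral_lintegral_swap hmeas.aemeasurable
    _ ≤ ∫⁻ s in Ioi (0 : ℝ), ENNReal.ofReal (1 / m) * ENNReal.ofReal (-C' s * C s ^ r) :=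
        setLIntegral_mono' measurableSet_Ioi hslice
    _ = ENNReal.ofReal (1 / m) * ∫⁻ s in Ioi (0 : ℝ), ENNReal.ofReal (-C' s * C s ^ r) :=
        lintegral_const_mul' _ _ ENNReal.ofReal_ne_top
    _ ≤ ENNReal.ofReal (1 / m) * ENNReal.ofReal (1 / (r + 1)) :=
        mul_le_mul_right (hC.lintegral_rpow_mul_neg_deriv_le hr0) _
    _ = _ := by rw [← ENNReal.ofReal_mul (by positivity), hmr]

/-- Pointwise bound on the re-weighted objective, for scores `a` of the positives, summed scores `b`
of the negatives in each row, and `t` the position of `α` between `m / (n (m - 1) + 1)` and `1`. -/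
lemma reweighted_cpc_integrand_le {n m : ℕ} (hn : 1 ≤ n) (hm : 2 ≤ m) (a b r : Fin n → ℝ)
    (ha : ∀ i, 0 < a i) (hb : ∀ i, 0 ≤ b i) {t : ℝ} (ht0 : 0 ≤ t) (ht1 : t ≤ 1) {α : ℝ}
    (hα : α = t + (1 - t) * (m / (n * ((m : ℝ) - 1) + 1))) :
    (1 / (n : ℝ)) * ∑ i, Real.log ((n : ℝ) * m * a i
        / (α * ∑ j, a j + ((m - α) / ((m : ℝ) - 1)) * ∑ j, b j))
      ≤ (1 / (n : ℝ)) * ∑ i, (r i + (t * m * (Real.exp (-r i) * a i / (a i + b i))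
          + (1 - t) * (n * ((m : ℝ) - 1) + 1)
            * (Real.exp (-r i) * a i / (a i + ∑ j, b j)) - 1)) := by
  have hn' : (1 : ℝ) ≤ n := by exact_mod_cast hn
  have hm' : (2 : ℝ) ≤ m := by exact_mod_cast hm
  have hM : 0 < (n : ℝ) * ((m : ℝ) - 1) + 1 := by nlinarith
  set β : ℝ := m / (n * ((m : ℝ) - 1) + 1) with hβ
  have hβ0 : 0 < β := div_pos (by linarith) hM
  have hmβ : (m : ℝ) / β = n * ((m : ℝ) - 1) + 1 := by
    rw [hβ, div_div_cancel₀ (by linarith)]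
  set N := ∑ j, b j with hN
  have hN0 : 0 ≤ N := Finset.sum_nonneg fun j _ => hb j
  set c : Fin n → ℝ := fun i => t * (a i + b i) + (1 - t) * (β * (a i + N)) with hc
  have hu : ∀ i, 0 < a i + b i := fun i => add_pos_of_pos_of_nonneg (ha i) (hb i)
  have hv : ∀ i, 0 < β * (a i + N) := fun i =>
    mul_pos hβ0 (add_pos_of_pos_of_nonneg (ha i) hN0)
  have hconv : ∀ i, 0 < c i ∧ 1 / c i ≤ t * (1 / (a i + b i)) + (1 - t) * (1 / (β * (a i + N))) := by
    intro i
    have hu := hu i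
    have hv := hv i
    simp only [hc]
    generalize a i + b i = u at *
    generalize β * (a i + N) = v at *
    have hpos : 0 < t * u + (1 - t) * v := by
      rcases ht0.eq_or_lt with h | h
      · rw [← h]; simpa using hv
      · exact add_pos_of_pos_of_nonneg (mul_pos h hu) (mul_nonneg (by linarith) hv.le)
    refine ⟨hpos, ?_⟩
    rw [div_le_iff₀ hpos]
    have h1 : (t * (1 / u) + (1 - t) * (1 / v)) * (t * u + (1 - t) * v)
        = 1 + t * (1 - t) * ((u - v) ^ 2 / (u * v)) := by
      field_simp
      ring
    rw [h1]
    have : 0 ≤ t * (1 - t) * ((u - v) ^ 2 / (u * v)) :=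
      mul_nonneg (mul_nonneg ht0 (by linarith)) (by positivity)
    linarith
  have hD : α * ∑ j, a j + ((m - α) / ((m : ℝ) - 1)) * N = ∑ j, c j := by
    have h1 : ∑ j, c j = (t + (1 - t) * β) * ∑ j, a j + (t + (1 - t) * β * n) * N := by
      simp only [hc, mul_add, Finset.sum_add_distrib, Finset.sum_const, Finset.card_univ,
        Fintype.card_fin, nsmul_eq_mul, ← Finset.mul_sum, ← hN]
      ring
    rw [h1, hα]
    congr 2
    have hm1 : (m : ℝ) - 1 ≠ 0 := by linarith
    rw [div_eq_iff hm1]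
    have h2 : β * (n * ((m : ℝ) - 1) + 1) = m := by
      rw [hβ, div_mul_cancel₀ _ hM.ne']
    linear_combination -(1 - t) * h2
  rw [hD]
  set D := ∑ j, c j with hDdef
  have hD0 : 0 < D := Finset.sum_pos (fun j _ => (hconv j).1) ⟨⟨0, hn⟩, Finset.mem_univ _⟩
  refine mul_le_mul_of_nonneg_left ?_ (by positivity)
  have hterm : ∀ i, Real.log ((n : ℝ) * m * a i / D)
      ≤ (r i + (t * m * (Real.exp (-r i) * a i / (a i + b i))
          + (1 - t) * (n * ((m : ℝ) - 1) + 1) * (Real.exp (-r i) * a i / (a i + N)) - 1))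
        + (n * c i / D - 1) := by
    intro i
    have hci := (hconv i).1
    have hai := ha i
    have e1 : (n : ℝ) * m * a i / D
        = Real.exp (r i) * (Real.exp (-r i) * (m * a i / c i)) * (n * c i / D) := by
      rw [Real.exp_neg]
      have := Real.exp_pos (r i)
      field_simp
    have p1 : 0 < Real.exp (-r i) * (m * a i / c i) := by positivity
    have p2 : 0 < n * c i / D := by positivity
    rw [e1, Real.log_mul (by positivity) p2.ne', Real.log_mul (by positivity) p1.ne', Real.log_exp]
    have l1 := Real.log_le_sub_one_of_pos p1
    have l2 := Real.log_le_sub_one_of_pos p2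
    have l3 : Real.exp (-r i) * (m * a i / c i)
        ≤ t * m * (Real.exp (-r i) * a i / (a i + b i))
          + (1 - t) * (n * ((m : ℝ) - 1) + 1) * (Real.exp (-r i) * a i / (a i + N)) := by
      have h := mul_le_mul_of_nonneg_left (hconv i).2
        (show 0 ≤ Real.exp (-r i) * (m * a i) by positivity)
      have hN1 : a i + N ≠ 0 := by positivity
      have hb1 := (hu i).ne'
      rw [← hmβ]
      calc _ = Real.exp (-r i) * (m * a i) * (1 / c i) := by ring
        _ ≤ _ := h
        _ = _ := by field_simp
    linarith
  refine (Finset.sum_le_sum fun i _ => hterm i).trans (le_of_eq ?_)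
  rw [Finset.sum_add_distrib, add_eq_left, Finset.sum_sub_distrib, ← Finset.sum_div,
    ← Finset.mul_sum, ← hDdef, mul_div_cancel_right₀ _ hD0.ne']
  simp

/-- Re-weighted multi-label CPC is a lower bound on the mutual information
`I(X;Y) = D_KL(p(x,y) ‖ p(x)p(y))` for every `α ∈ [m/(n(m-1)+1), 1]`. The
expectation defining `J_α(g)` is over `n` positive pairs drawn i.i.d. from the
joint law `μ` and, independently, `n(m-1)` negative samples drawn i.i.d. from
the marginal of `Y`. -/
theorem stmt3 {𝒳 𝒴 : Type*} [MeasurableSpace 𝒳] [MeasurableSpace 𝒴]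
    (μ : Measure (𝒳 × 𝒴)) [IsProbabilityMeasure μ]
    (hac : μ ≪ (μ.map Prod.fst).prod (μ.map Prod.snd))
    (n m : ℕ) (hn : 1 ≤ n) (hm : 2 ≤ m)
    (α : ℝ) (hα_lb : (m : ℝ) / ((n : ℝ) * ((m : ℝ) - 1) + 1) ≤ α) (hα_ub : α ≤ 1)
    (g : 𝒳 × 𝒴 → ℝ) (hg : Measurable g) (hgpos : ∀ p, 0 < g p) :
    ((∫ p : (Fin n → 𝒳 × 𝒴) × (Fin n → Fin (m - 1) → 𝒴),
        (1 / (n : ℝ)) * ∑ i : Fin n,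
          Real.log ((n : ℝ) * (m : ℝ) * g (p.1 i) /
            (α * ∑ j : Fin n, g (p.1 j)
              + (((m : ℝ) - α) / ((m : ℝ) - 1)) *
                  ∑ j : Fin n, ∑ k : Fin (m - 1), g ((p.1 j).1, p.2 j k)))
        ∂((Measure.pi fun _ : Fin n => μ).prod
            (Measure.pi fun _ : Fin n => Measure.pi fun _ : Fin (m - 1) => μ.map Prod.snd)) : ℝ) : EReal)
      ≤ klDiv μ ((μ.map Prod.fst).prod (μ.map Prod.snd)) := by
  unfold klDiv
  split_ifs with hkl
  swap
  · exact le_top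
  rw [EReal.coe_le_coe_iff]
  have hint := hkl.2
  have hn' : (1 : ℝ) ≤ n := by exact_mod_cast hn
  have hm' : (2 : ℝ) ≤ m := by exact_mod_cast hm
  have hM : 0 < (n : ℝ) * ((m : ℝ) - 1) + 1 := by nlinarith
  have : IsProbabilityMeasure (μ.map Prod.fst) :=
    Measure.isProbabilityMeasure_map measurable_fst.aemeasurable
  have : IsProbabilityMeasure (μ.map Prod.snd) :=
    Measure.isProbabilityMeasure_map measurable_snd.aemeasurable
  have hX := fun i : Fin n =>
    lintegral_weighted_ratio_le μ hac hm g hg hgpos {i} (Finset.mem_singleton_self i)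
  have hY := fun i : Fin n =>
    lintegral_weighted_ratio_le μ hac hm g hg hgpos Finset.univ (Finset.mem_univ i)
  set ν := μ.map Prod.snd with hν
  set q := (μ.map Prod.fst).prod ν with hq
  set Pn := (Measure.pi fun _ : Fin n => μ).prod
    (Measure.pi fun _ : Fin n => Measure.pi fun _ : Fin (m - 1) => ν) with hPn
  have hllr : Measurable (llr μ q) := measurable_llr μ q
  by_cases hF : Integrable (fun p : (Fin n → 𝒳 × 𝒴) × (Fin n → Fin (m - 1) → 𝒴) =>
        (1 / (n : ℝ)) * ∑ i : Fin n,
          Real.log ((n : ℝ) * (m : ℝ) * g (p.1 i) /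
            (α * ∑ j : Fin n, g (p.1 j)
              + (((m : ℝ) - α) / ((m : ℝ) - 1)) *
                  ∑ j : Fin n, ∑ k : Fin (m - 1), g ((p.1 j).1, p.2 j k)))) Pn
  swap
  · rw [integral_undef hF]
    simpa using InformationTheory.integral_llr_add_sub_measure_univ_nonneg hkl.1 hint
  obtain ⟨t, ht0, ht1, hα⟩ : ∃ t : ℝ, 0 ≤ t ∧ t ≤ 1 ∧
      α = t + (1 - t) * (m / (n * ((m : ℝ) - 1) + 1)) := by
    have hmem : α ∈ segment ℝ ((m : ℝ) / (n * ((m : ℝ) - 1) + 1)) 1 := by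
      rw [segment_eq_Icc (hα_lb.trans hα_ub)]
      exact ⟨hα_lb, hα_ub⟩
    obtain ⟨s, t, hs, ht, hst, h⟩ := hmem
    refine ⟨t, ht, by linarith, ?_⟩
    rw [← h, ← eq_sub_of_add_eq hst]
    simp only [smul_eq_mul]
    ring
  have hratio : ∀ (w : (Fin n → 𝒳 × 𝒴) × (Fin n → Fin (m - 1) → 𝒴) → ℝ) (c : ℝ), Measurable w →
      (∀ p, 0 ≤ w p) → 0 ≤ c → ∫⁻ p, ENNReal.ofReal (w p) ∂Pn ≤ ENNReal.ofReal c →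
      Integrable w Pn ∧ ∫ p, w p ∂Pn ≤ c := by
    intro w c hw hw0 hc hle
    have hi : Integrable w Pn :=
      (lintegral_ofReal_ne_top_iff_integrable hw.aestronglyMeasurable (ae_of_all _ hw0)).1
        (hle.trans_lt ENNReal.ofReal_lt_top).ne
    refine ⟨hi, ?_⟩
    rwa [← ofReal_integral_eq_lintegral_ofReal hi (ae_of_all _ hw0),
      ENNReal.ofReal_le_ofReal_iff hc] at hle
  have hXi := fun i => hratio _ _ (by fun_prop) (fun p => div_nonneg
    (mul_nonneg (Real.exp_pos _).le (hgpos _).le) (add_nonneg (hgpos _).le (Finset.sum_nonneg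
      fun j _ => Finset.sum_nonneg fun k _ => (hgpos _).le))) (by
        rw [Finset.card_singleton]; exact div_nonneg zero_le_one (by push_cast; linarith)) (hX i)
  have hYi := fun i => hratio _ _ (by fun_prop) (fun p => div_nonneg
    (mul_nonneg (Real.exp_pos _).le (hgpos _).le) (add_nonneg (hgpos _).le (Finset.sum_nonneg
      fun j _ => Finset.sum_nonneg fun k _ => (hgpos _).le))) (by
        rw [Finset.card_univ, Fintype.card_fin]; exact (div_pos one_pos hM).le) (hY i)
  simp only [Finset.sum_singleton, Finset.card_singleton, Nat.cast_one, one_mul, sub_add_cancel]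
    at hXi
  simp only [Finset.card_univ, Fintype.card_fin] at hYi
  have hmp : ∀ i : Fin n, MeasurePreserving
      (fun p : (Fin n → 𝒳 × 𝒴) × (Fin n → Fin (m - 1) → 𝒴) => p.1 i) Pn μ := fun i =>
    (measurePreserving_eval (fun _ : Fin n => μ) i).comp measurePreserving_fst
  have hri : ∀ i : Fin n, Integrable (fun p => llr μ q (p.1 i)) Pn := fun i =>
    (hmp i).integrable_comp_of_integrable hint
  have hrv : ∀ i : Fin n, ∫ p, llr μ q (p.1 i) ∂Pn = ∫ z, llr μ q z ∂μ := fun i => by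
    have h := integral_map (μ := Pn) (hmp i).measurable.aemeasurable (f := llr μ q)
      hllr.aestronglyMeasurable
    rw [(hmp i).map_eq] at h
    exact h.symm
  have hb : ∀ i : Fin n, Integrable (fun p => llr μ q (p.1 i)
        + (t * m * (Real.exp (-llr μ q (p.1 i)) * g (p.1 i)
            / (g (p.1 i) + ∑ k, g ((p.1 i).1, p.2 i k)))
          + (1 - t) * (n * ((m : ℝ) - 1) + 1) * (Real.exp (-llr μ q (p.1 i)) * g (p.1 i)
            / (g (p.1 i) + ∑ j, ∑ k, g ((p.1 j).1, p.2 j k))) - 1)) Pn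
      ∧ ∫ p, (llr μ q (p.1 i)
        + (t * m * (Real.exp (-llr μ q (p.1 i)) * g (p.1 i)
            / (g (p.1 i) + ∑ k, g ((p.1 i).1, p.2 i k)))
          + (1 - t) * (n * ((m : ℝ) - 1) + 1) * (Real.exp (-llr μ q (p.1 i)) * g (p.1 i)
            / (g (p.1 i) + ∑ j, ∑ k, g ((p.1 j).1, p.2 j k))) - 1)) ∂Pn
        ≤ ∫ z, llr μ q z ∂μ := by
    intro i
    have hb1 := (hXi i).1.const_mul (t * m)
    have hb2 := (hYi i).1.const_mul ((1 - t) * (n * ((m : ℝ) - 1) + 1))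
    have hb3 := (hb1.add hb2).sub (integrable_const (1 : ℝ))
    refine ⟨(hri i).add hb3, ?_⟩
    have e1 := integral_add (hri i) hb3
    have e2 := integral_sub (hb1.add hb2) (integrable_const (1 : ℝ))
    have e3 := integral_add hb1 hb2
    simp only [Pi.add_apply, Pi.sub_apply] at e1 e2 e3
    rw [e1, hrv i, e2, e3, integral_const_mul, integral_const_mul]
    have h1 := mul_le_mul_of_nonneg_left (hXi i).2 (show 0 ≤ t * m by positivity)
    have h2 := mul_le_mul_of_nonneg_left (hYi i).2
      (show 0 ≤ (1 - t) * (n * ((m : ℝ) - 1) + 1) from mul_nonneg (by linarith) hM.le)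
    have h3 : t * m * (1 / m) = t := by field_simp
    have h4 : (1 - t) * (n * ((m : ℝ) - 1) + 1) * (1 / (n * ((m : ℝ) - 1) + 1)) = 1 - t := by
      field_simp
    simp only [integral_const, probReal_univ, smul_eq_mul, mul_one]
    linarith
  refine (integral_mono hF ((integrable_finsetSum _ fun i _ => (hb i).1).const_mul (1 / (n : ℝ)))
    fun p => reweighted_cpc_integrand_le hn hm (fun i => g (p.1 i))
      (fun i => ∑ k, g ((p.1 i).1, p.2 i k)) (fun i => llr μ q (p.1 i)) (fun i => hgpos _)
      (fun i => Finset.sum_nonneg fun k _ => (hgpos _).le) ht0 ht1 hα).trans ?_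
  rw [integral_const_mul, integral_finsetSum _ fun i _ => (hb i).1]
  refine (mul_le_mul_of_nonneg_left (Finset.sum_le_sum fun i _ => (hb i).2)
    (by positivity)).trans (le_of_eq ?_)
  simp only [Finset.sum_const, Finset.card_univ, Fintype.card_fin, nsmul_eq_mul]
  field_simp
end

section
/- Let X be a measurable space and let P and Q be probability measures on X with P absolutely continuous with respect to Q. Then D_KL(P ‖ Q) = sup_T ( ∫ T dP − ∫ e^T dQ + 1 ), where the supremum is taken over all bounded measurable functions T : X → ℝ. -/
open MeasureTheory Real
open scoped Classical

/-- Fenchel–Young inequality for `x ↦ x * log x` and its conjugate. -/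
lemma mul_sub_exp_add_one_le_klFun {r : ℝ} (hr : 0 ≤ r) (t : ℝ) :
    r * t - exp t + 1 ≤ InformationTheory.klFun r := by
  rw [InformationTheory.klFun_apply]
  rcases hr.eq_or_lt with rfl | hr
  · simp [exp_nonneg]
  · have h := add_one_le_exp (t - log r)
    rw [exp_sub, exp_log hr, le_div_iff₀ hr] at h
    linarith

/-- The truncation of `r` to the interval `[exp (-n), exp n]`. -/
noncomputable def expClamp (n : ℕ) (r : ℝ) : ℝ := max (exp (-n)) (min (exp n) r)

lemma exp_neg_le_expClamp (n : ℕ) (r : ℝ) : exp (-n) ≤ expClamp n r := le_max_left _ _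

lemma expClamp_pos (n : ℕ) (r : ℝ) : 0 < expClamp n r :=
  (exp_pos _).trans_le (exp_neg_le_expClamp n r)

lemma expClamp_le_exp (n : ℕ) (r : ℝ) : expClamp n r ≤ exp n :=
  max_le (exp_le_exp.2 (neg_le_self n.cast_nonneg)) (min_le_left _ _)

lemma abs_log_expClamp_le (n : ℕ) (r : ℝ) : |log (expClamp n r)| ≤ n :=
  abs_le.2 ⟨(le_log_iff_exp_le (expClamp_pos n r)).2 (exp_neg_le_expClamp n r),
    (log_le_iff_le_exp (expClamp_pos n r)).2 (expClamp_le_exp n r)⟩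

lemma measurable_expClamp (n : ℕ) : Measurable (expClamp n) := by
  unfold expClamp
  fun_prop

lemma tendsto_expClamp {r : ℝ} (hr : 0 ≤ r) :
    Filter.Tendsto (fun n ↦ expClamp n r) Filter.atTop (nhds r) := by
  have h₀ : Filter.Tendsto (fun n : ℕ ↦ exp (-n)) Filter.atTop (nhds 0) :=
    tendsto_exp_neg_atTop_nhds_zero.comp tendsto_natCast_atTop_atTop
  have h_min : Filter.Tendsto (fun n : ℕ ↦ min (exp n) r) Filter.atTop (nhds r) := by
    refine tendsto_const_nhds.congr' ?_
    filter_upwards [(tendsto_exp_atTop.comp tendsto_natCast_atTop_atTop).eventually_ge_atTop r]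
      with n hn
    exact (min_eq_right hn).symm
  simpa [expClamp, hr] using h₀.max h_min

lemma mul_log_expClamp_sub_add_one_nonneg (n : ℕ) (r : ℝ) :
    0 ≤ r * log (expClamp n r) - expClamp n r + 1 := by
  have h_kl := InformationTheory.klFun_nonneg (expClamp_pos n r).le
  rw [InformationTheory.klFun_apply] at h_kl
  suffices 0 ≤ (r - expClamp n r) * log (expClamp n r) by linarith
  rcases lt_trichotomy (expClamp n r) 1 with h | h | h
  · refine mul_nonneg_of_nonpos_of_nonpos (sub_nonpos.2 ?_) (log_neg (expClamp_pos n r) h).le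
    have h_min : min (exp n) r ≤ expClamp n r := le_max_right _ _
    exact (min_le_iff.1 h_min).resolve_left
      fun h' ↦ (h'.trans_lt h).not_ge (one_le_exp n.cast_nonneg)
  · simp [h]
  · refine mul_nonneg (sub_nonneg.2 ?_) (log_pos h).le
    refine ((le_max_iff.1 le_rfl : expClamp n r ≤ _ ∨ _).resolve_left ?_).trans (min_le_right _ _)
    exact fun h' ↦ (h.trans_le h').not_ge (exp_le_one_iff.2 (neg_nonpos.2 n.cast_nonneg))

lemma tendsto_mul_log_expClamp_sub_add_one {r : ℝ} (hr : 0 ≤ r) :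
    Filter.Tendsto (fun n ↦ r * log (expClamp n r) - expClamp n r + 1) Filter.atTop
      (nhds (InformationTheory.klFun r)) := by
  have h_log : Filter.Tendsto (fun n ↦ r * log (expClamp n r)) Filter.atTop
      (nhds (r * log r)) := by
    rcases eq_or_ne r 0 with rfl | hr'
    · simp
    · exact ((tendsto_expClamp hr).log hr').const_mul r
  rw [InformationTheory.klFun_apply, add_sub_right_comm]
  exact (h_log.sub (tendsto_expClamp hr)).add_const 1

section

variable {X : Type*} [MeasurableSpace X] {P Q : Measure X}

lemma integrable_of_abs_le {T : X → ℝ} [IsFiniteMeasure P] (hT : Measurable T) {C : ℝ}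
    (hC : ∀ x, |T x| ≤ C) : Integrable T P :=
  .of_bound hT.aestronglyMeasurable C (.of_forall hC)

lemma integrable_exp_of_abs_le {T : X → ℝ} [IsFiniteMeasure P] (hT : Measurable T) {C : ℝ}
    (hC : ∀ x, |T x| ≤ C) : Integrable (fun x ↦ exp (T x)) P :=
  integrable_of_abs_le hT.exp (C := exp C) fun x ↦ by
    simpa [abs_exp] using (abs_le.1 (hC x)).2

lemma integrable_rnDeriv_mul_sub_exp [IsFiniteMeasure P] [IsFiniteMeasure Q] (hPQ : P ≪ Q)
    {T : X → ℝ} (hT : Measurable T) {C : ℝ} (hC : ∀ x, |T x| ≤ C) :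
    Integrable (fun x ↦ (P.rnDeriv Q x).toReal * T x - exp (T x) + 1) Q :=
  (((integrable_rnDeriv_smul_iff hPQ).2 (integrable_of_abs_le hT hC)).sub
    (integrable_exp_of_abs_le hT hC)).add (integrable_const 1)

lemma integral_rnDeriv_mul_sub_exp [IsFiniteMeasure P] [IsProbabilityMeasure Q] (hPQ : P ≪ Q)
    {T : X → ℝ} (hT : Measurable T) {C : ℝ} (hC : ∀ x, |T x| ≤ C) :
    ∫ x, ((P.rnDeriv Q x).toReal * T x - exp (T x) + 1) ∂Q
      = (∫ x, T x ∂P) - (∫ x, exp (T x) ∂Q) + 1 := by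
  have h_mul : Integrable (fun x ↦ (P.rnDeriv Q x).toReal * T x) Q :=
    (integrable_rnDeriv_smul_iff hPQ).2 (integrable_of_abs_le hT hC)
  have h_exp : Integrable (fun x ↦ exp (T x)) Q := integrable_exp_of_abs_le hT hC
  have h_sub : Integrable (fun x ↦ (P.rnDeriv Q x).toReal * T x - exp (T x)) Q := h_mul.sub h_exp
  rw [integral_add h_sub (integrable_const 1), integral_sub h_mul h_exp,
    ← integral_rnDeriv_smul hPQ (f := T)]
  simp

lemma klDiv_eq_coe_klDiv [IsProbabilityMeasure P] [IsProbabilityMeasure Q] :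
    klDiv P Q = (InformationTheory.klDiv P Q : EReal) := by
  rw [klDiv]
  split_ifs with h
  · rw [← InformationTheory.toReal_klDiv_of_measure_eq h.1 (by simp),
      EReal.coe_ennreal_toReal (InformationTheory.klDiv_ne_top h.1 h.2)]
  · rw [InformationTheory.klDiv_eq_top_iff.2 (not_and.1 h), EReal.coe_ennreal_top]

lemma integral_sub_integral_exp_le_klDiv [IsProbabilityMeasure P] [IsProbabilityMeasure Q]
    (hPQ : P ≪ Q) {T : X → ℝ} (hT : Measurable T) {C : ℝ} (hC : ∀ x, |T x| ≤ C) :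
    (((∫ x, T x ∂P) - (∫ x, exp (T x) ∂Q) + 1 : ℝ) : EReal) ≤ klDiv P Q := by
  rw [klDiv]
  split_ifs with h
  · have h_kl := InformationTheory.integral_klFun_rnDeriv hPQ h.2
    rw [probReal_univ, probReal_univ, add_sub_cancel_right] at h_kl
    rw [EReal.coe_le_coe_iff, ← integral_rnDeriv_mul_sub_exp hPQ hT hC, ← h_kl]
    exact integral_mono (integrable_rnDeriv_mul_sub_exp hPQ hT hC)
      ((InformationTheory.integrable_klFun_rnDeriv_iff hPQ).2 h.2)
      fun x ↦ mul_sub_exp_add_one_le_klFun ENNReal.toReal_nonneg (T x)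
  · exact le_top

lemma klDiv_le_of_forall_integral_sub_integral_exp_le [IsProbabilityMeasure P]
    [IsProbabilityMeasure Q] (hPQ : P ≪ Q) {S : EReal}
    (hS : ∀ T : X → ℝ, Measurable T → (∃ C : ℝ, ∀ x, |T x| ≤ C) →
      (((∫ x, T x ∂P) - (∫ x, exp (T x) ∂Q) + 1 : ℝ) : EReal) ≤ S) :
    klDiv P Q ≤ S := by
  have hS₀ : 0 ≤ S := by simpa using hS 0 measurable_const ⟨0, by simp⟩
  rw [klDiv_eq_coe_klDiv, ← EReal.coe_toENNReal hS₀, EReal.coe_ennreal_le_coe_ennreal_iff,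
    InformationTheory.klDiv_eq_lintegral_klFun_of_ac hPQ]
  let r (x : X) : ℝ := (P.rnDeriv Q x).toReal
  have hr : Measurable r := (Measure.measurable_rnDeriv P Q).ennreal_toReal
  let g (n : ℕ) (x : X) : ℝ := r x * log (expClamp n (r x)) - expClamp n (r x) + 1
  have hg (n : ℕ) : ∫⁻ x, ENNReal.ofReal (g n x) ∂Q ≤ S.toENNReal := by
    have hT : Measurable fun x ↦ log (expClamp n (r x)) := ((measurable_expClamp n).comp hr).log
    have hC (x : X) := abs_log_expClamp_le n (r x)
    have h_int := integrable_rnDeriv_mul_sub_exp hPQ hT hC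
    have h_eq := integral_rnDeriv_mul_sub_exp hPQ hT hC
    have h_le := hS _ hT ⟨n, hC⟩
    rw [← h_eq] at h_le
    simp only [exp_log (expClamp_pos n _)] at h_int h_le
    rw [← ofReal_integral_eq_lintegral_ofReal h_int
      (.of_forall fun x ↦ mul_log_expClamp_sub_add_one_nonneg n (r x))]
    simpa using EReal.toENNReal_le_toENNReal h_le
  calc ∫⁻ x, ENNReal.ofReal (InformationTheory.klFun (r x)) ∂Q
    _ = ∫⁻ x, Filter.liminf (fun n ↦ ENNReal.ofReal (g n x)) Filter.atTop ∂Q :=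
      lintegral_congr fun x ↦ ((ENNReal.tendsto_ofReal
        (tendsto_mul_log_expClamp_sub_add_one ENNReal.toReal_nonneg)).liminf_eq).symm
    _ ≤ Filter.liminf (fun n ↦ ∫⁻ x, ENNReal.ofReal (g n x) ∂Q) Filter.atTop := by
      refine lintegral_liminf_le fun n ↦ ?_
      have := (measurable_expClamp n).comp hr
      exact (((hr.mul this.log).sub this).add_const 1).ennreal_ofReal
    _ ≤ S.toENNReal :=
      (Filter.liminf_le_liminf (.of_forall hg)).trans (Filter.liminf_const _).le

end

/-- Variational (Fenchel-dual) representation of the KL divergence: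
`D_KL(P ‖ Q) = sup_T (∫ T dP − ∫ e^T dQ + 1)`, the supremum (in the extended
reals) being over all bounded measurable functions `T : X → ℝ`. -/
theorem stmt4 {X : Type*} [MeasurableSpace X] (P Q : Measure X)
    [IsProbabilityMeasure P] [IsProbabilityMeasure Q] (hPQ : P ≪ Q) :
    klDiv P Q = ⨆ (T : X → ℝ) (_ : Measurable T) (_ : ∃ C : ℝ, ∀ x, |T x| ≤ C),
      (((∫ x, T x ∂P) - (∫ x, Real.exp (T x) ∂Q) + 1 : ℝ) : EReal) := by
  refine le_antisymm ?_ ?_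
  · refine klDiv_le_of_forall_integral_sub_integral_exp_le hPQ fun T hT hC ↦ ?_
    exact le_iSup_of_le T (le_iSup₂_of_le hT hC le_rfl)
  · exact iSup_le fun T ↦ iSup₂_le fun hT ⟨_, hC⟩ ↦
      integral_sub_integral_exp_le_klDiv hPQ hT hC
end

section
/- Let n ≥ 1 and m ≥ 2 be integers, and for each i ∈ {1,…,n} let X_i, X̄_{i,1}, X̄_{i,2}, …, X̄_{i,m−1} be strictly positive real-valued random variables such that, for each i, the m-tuple (X_i, X̄_{i,1}, …, X̄_{i,m−1}) is exchangeable. Then for every real α with 1 ≤ α ≤ m/2, E[ (1/n) Σ_{i=1}^n ( m X_i / ( α X_i + ((m−α)/(m−1)) Σ_{j=1}^{m−1} X̄_{i,j} ) ) ] ≤ 1. -/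
open MeasureTheory

/-- The `m`-tuple obtained by prepending `x` to the `(m-1)`-tuple `y`, as a
function `Fin m → ℝ`. -/
def jointVec {m : ℕ} (x : ℝ) (y : Fin (m - 1) → ℝ) : Fin m → ℝ :=
  fun k => if _ : (k : ℕ) = 0 then x else y ⟨(k : ℕ) - 1, by have := k.isLt; omega⟩

/-- The tangent line bound at the uniform point behind Jensen's inequality for the concave
function `x ↦ x / (α x + β (1 - x))`, where `α + (m - 1) β = m`. -/
lemma div_le_tangent {m α β z S : ℝ} (hm : 0 < m) (hβ : 0 ≤ β) (hβα : β ≤ α)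
    (hsum : α + (m - 1) * β = m) (hS : 0 < S) (hden : 0 < α * z + β * (S - z)) :
    m * z / (α * z + β * (S - z)) ≤ 1 + β * (m * z / S - 1) := by
  have hα : α = m - (m - 1) * β := by linarith
  rw [div_le_iff₀ hden]
  have key : (1 + β * (m * z / S - 1)) * (α * z + β * (S - z)) - m * z
      = β * (α - β) * (m * z - S) ^ 2 / (m * S) := by
    subst hα
    field_simp
    ring
  have : 0 ≤ β * (α - β) * (m * z - S) ^ 2 / (m * S) := by
    have := sub_nonneg.2 hβα
    positivity
  linarith

lemma sum_div_le_card {m : ℕ} {α β : ℝ} (hm : 0 < m) (hβ : 0 ≤ β) (hα : 0 < α) (hβα : β ≤ α)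
    (hsum : α + ((m : ℝ) - 1) * β = m) {z : Fin m → ℝ} (hz : ∀ k, 0 < z k) :
    ∑ k, (m : ℝ) * z k / (α * z k + β * (∑ l, z l - z k)) ≤ m := by
  have hne : (Finset.univ : Finset (Fin m)).Nonempty := ⟨⟨0, hm⟩, Finset.mem_univ _⟩
  have hS : 0 < ∑ l, z l := Finset.sum_pos (fun l _ => hz l) hne
  have hle : ∀ k, z k ≤ ∑ l, z l := fun k =>
    Finset.single_le_sum (fun l _ => (hz l).le) (Finset.mem_univ k)
  calc ∑ k, (m : ℝ) * z k / (α * z k + β * (∑ l, z l - z k))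
      ≤ ∑ k, (1 + β * (m * z k / ∑ l, z l - 1)) := by
        refine Finset.sum_le_sum fun k _ => div_le_tangent (by exact_mod_cast hm) hβ hβα hsum hS ?_
        have := mul_nonneg hβ (sub_nonneg.2 (hle k))
        have := mul_pos hα (hz k)
        linarith
    _ = m := by
        simp only [Finset.sum_add_distrib, ← Finset.mul_sum, Finset.sum_sub_distrib,
          ← Finset.sum_div, Finset.sum_const, Finset.card_univ, Fintype.card_fin, nsmul_eq_mul]
        rw [mul_div_assoc, div_self hS.ne']
        ring

/-- Each normalized ratio of a positive exchangeable tuple is integrable, with mean at most `1`. -/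
lemma integral_ratio_le_one {Ω : Type*} [MeasurableSpace Ω] (μ : Measure Ω)
    [IsProbabilityMeasure μ] {m : ℕ} {α β : ℝ} (hβ : 0 ≤ β) (hα : 0 < α)
    (hβα : β ≤ α) (hsum : α + ((m : ℝ) - 1) * β = m) {Z : Ω → Fin m → ℝ} (hZ : Measurable Z)
    (hpos : ∀ ω k, 0 < Z ω k)
    (hexch : ∀ σ : Equiv.Perm (Fin m), μ.map (fun ω => Z ω ∘ σ) = μ.map Z) (k : Fin m) :
    Integrable (fun ω => (m : ℝ) * Z ω k / (α * Z ω k + β * (∑ l, Z ω l - Z ω k))) μ ∧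
      ∫ ω, (m : ℝ) * Z ω k / (α * Z ω k + β * (∑ l, Z ω l - Z ω k)) ∂μ ≤ 1 := by
  have hm : 0 < m := k.pos
  let g : Fin m → (Fin m → ℝ) → ℝ := fun k z => (m : ℝ) * z k / (α * z k + β * (∑ l, z l - z k))
  have hg : ∀ k, Measurable (g k) := fun k => by fun_prop
  have hint : ∀ k, Integrable (fun ω => g k (Z ω)) μ := by
    intro k
    refine Integrable.of_bound ((hg k).comp hZ).aestronglyMeasurable (m / α)
      (Filter.Eventually.of_forall fun ω => ?_)
    have hz := hpos ω k
    have hle : Z ω k ≤ ∑ l, Z ω l :=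
      Finset.single_le_sum (fun l _ => (hpos ω l).le) (Finset.mem_univ k)
    have hrest := mul_nonneg hβ (sub_nonneg.2 hle)
    have hαz := mul_pos hα hz
    have hden : 0 < α * Z ω k + β * (∑ l, Z ω l - Z ω k) := by linarith
    rw [Real.norm_of_nonneg (by positivity), div_le_div_iff₀ hden hα]
    have := mul_nonneg (Nat.cast_nonneg (α := ℝ) m) hrest
    linarith
  have heq : ∀ j, ∫ ω, g j (Z ω) ∂μ = ∫ ω, g k (Z ω) ∂μ := by
    intro j
    have hσ : Measurable fun ω => Z ω ∘ Equiv.swap k j :=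
      measurable_pi_lambda _ fun l => (measurable_pi_apply _).comp hZ
    rw [← integral_map hZ.aemeasurable (hg j).aestronglyMeasurable, ← hexch (Equiv.swap k j),
      integral_map hσ.aemeasurable (hg j).aestronglyMeasurable]
    refine integral_congr_ae (Filter.Eventually.of_forall fun ω => ?_)
    simp only [g, Function.comp_apply, Equiv.swap_apply_right, Equiv.sum_comp (Equiv.swap k j) (Z ω)]
  refine ⟨hint k, ?_⟩
  have htotal : ∑ j, ∫ ω, g j (Z ω) ∂μ ≤ m := by
    rw [← integral_finsetSum _ fun j _ => hint j]
    calc ∫ ω, ∑ j, g j (Z ω) ∂μ ≤ ∫ _, (m : ℝ) ∂μ :=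
          integral_mono (integrable_finsetSum _ fun j _ => hint j) (integrable_const _)
            fun ω => sum_div_le_card hm hβ hα hβα hsum (hpos ω)
      _ = m := by simp
  simp only [heq, Finset.sum_const, Finset.card_univ, Fintype.card_fin, nsmul_eq_mul] at htotal
  have hm' : (0 : ℝ) < m := by exact_mod_cast hm
  exact le_of_mul_le_mul_left (by simpa using htotal) hm'

lemma sum_jointVec {m : ℕ} (hm : 0 < m) (x : ℝ) (y : Fin (m - 1) → ℝ) :
    ∑ k, jointVec x y k = x + ∑ j, y j := by
  obtain ⟨p, rfl⟩ := Nat.exists_eq_succ_of_ne_zero hm.ne'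
  rw [Fin.sum_univ_succ]
  simp [jointVec]

/-- If for each `i` the `m`-tuple `(X_i, X̄_{i,1}, …, X̄_{i,m-1})` of strictly
positive random variables is exchangeable, then for every `α ∈ [1, m/2]`,
`E[(1/n) Σ_i m X_i / (α X_i + ((m-α)/(m-1)) Σ_j X̄_{i,j})] ≤ 1`. -/
theorem stmt6 {Ω : Type*} [MeasurableSpace Ω] (μ : Measure Ω) [IsProbabilityMeasure μ]
    (n m : ℕ) (hn : 1 ≤ n) (hm : 2 ≤ m)
    (X : Fin n → Ω → ℝ) (Y : Fin n → Fin (m - 1) → Ω → ℝ)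
    (hX : ∀ i, Measurable (X i)) (hY : ∀ i j, Measurable (Y i j))
    (hXpos : ∀ i ω, 0 < X i ω) (hYpos : ∀ i j ω, 0 < Y i j ω)
    (hexch : ∀ (i : Fin n) (σ : Equiv.Perm (Fin m)),
      μ.map (fun ω => (jointVec (X i ω) (fun j => Y i j ω)) ∘ σ)
        = μ.map (fun ω => jointVec (X i ω) (fun j => Y i j ω)))
    (α : ℝ) (hα1 : 1 ≤ α) (hα : α ≤ (m : ℝ) / 2) :
    ∫ ω, (1 / (n : ℝ)) * ∑ i : Fin n,
        ((m : ℝ) * X i ω /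
          (α * X i ω + (((m : ℝ) - α) / ((m : ℝ) - 1)) * ∑ j : Fin (m - 1), Y i j ω)) ∂μ
      ≤ 1 := by
  have hm0 : 0 < m := by omega
  have hm2 : (2 : ℝ) ≤ m := by exact_mod_cast hm
  have hm1 : (0 : ℝ) < (m : ℝ) - 1 := by linarith
  set β : ℝ := ((m : ℝ) - α) / ((m : ℝ) - 1) with hβdef
  have hβ : 0 ≤ β := div_nonneg (by linarith) hm1.le
  have hsum : α + ((m : ℝ) - 1) * β = m := by
    rw [hβdef]
    field_simp
    ring
  have hβα : β ≤ α := by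
    rw [hβdef, div_le_iff₀ hm1]
    nlinarith
  have hratio : ∀ i,
      Integrable (fun ω => (m : ℝ) * X i ω / (α * X i ω + β * ∑ j, Y i j ω)) μ ∧
        ∫ ω, (m : ℝ) * X i ω / (α * X i ω + β * ∑ j, Y i j ω) ∂μ ≤ 1 := by
    intro i
    have hmeas : Measurable fun ω => jointVec (X i ω) (fun j => Y i j ω) := by
      refine measurable_pi_lambda _ fun k => ?_
      unfold jointVec
      split_ifs
      · exact hX i
      · exact hY i _
    have hpos : ∀ ω k, 0 < jointVec (X i ω) (fun j => Y i j ω) k := by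
      intro ω k
      unfold jointVec
      split_ifs
      · exact hXpos i ω
      · exact hYpos i _ ω
    have hzero : ∀ ω, jointVec (X i ω) (fun j => Y i j ω) ⟨0, hm0⟩ = X i ω := by
      simp [jointVec]
    simpa only [sum_jointVec hm0, hzero, add_sub_cancel_left] using
      integral_ratio_le_one μ hβ (by linarith) hβα hsum hmeas hpos (hexch i) ⟨0, hm0⟩
  have hn0 : (0 : ℝ) < n := by exact_mod_cast hn
  rw [integral_const_mul, integral_finsetSum _ fun i _ => (hratio i).1, one_div,
    inv_mul_le_iff₀ hn0]
  simpa using Finset.sum_le_sum fun i (_ : i ∈ Finset.univ) => (hratio i).2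
end

section
/- Let X be a measurable space, Q a probability measure on X, r : X → ℝ a measurable function with r(x) > 0 for all x, and m ≥ 2 an integer. If x, y_1, …, y_{m−1} are drawn i.i.d. from Q, then E[ m · r(x) / ( r(x) + Σ_{i=1}^{m−1} r(y_i) ) ] ≤ 1, where the expectation is with respect to the product measure Q^m. -/
open MeasureTheory

section Exchangeable

variable {X ι : Type*} [MeasurableSpace X] [Fintype ι] {r : X → ℝ}

theorem integrable_pi_div_sum (μ : Measure (ι → X)) [IsFiniteMeasure μ]
    (hr : Measurable r) (hr0 : ∀ x, 0 ≤ r x) (i : ι) :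
    Integrable (fun v : ι → X => r (v i) / ∑ j, r (v j)) μ := by
  refine Integrable.of_bound (C := 1) (Measurable.aestronglyMeasurable (by fun_prop)) ?_
  refine .of_forall fun v => ?_
  have hs : 0 ≤ ∑ j, r (v j) := Finset.sum_nonneg fun j _ => hr0 _
  rw [Real.norm_of_nonneg (div_nonneg (hr0 _) hs)]
  exact div_le_one_of_le₀
    (Finset.single_le_sum (f := fun j => r (v j)) (fun j _ => hr0 _) (Finset.mem_univ i)) hs

theorem integral_pi_div_sum_eq (Q : Measure X) [SigmaFinite Q] (r : X → ℝ) (i k : ι) :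
    ∫ v : ι → X, r (v i) / ∑ j, r (v j) ∂(Measure.pi fun _ => Q) =
      ∫ v : ι → X, r (v k) / ∑ j, r (v j) ∂(Measure.pi fun _ => Q) := by
  classical
  let e := Equiv.swap i k
  have hval (v : ι → X) (j : ι) :
      MeasurableEquiv.piCongrLeft (fun _ : ι => X) e v j = v (e j) := by
    obtain ⟨j, rfl⟩ := e.surjective j
    rw [MeasurableEquiv.coe_piCongrLeft, Equiv.piCongrLeft_apply_apply]
    simp [e]
  rw [← (measurePreserving_piCongrLeft (fun _ : ι => Q) e).integral_comp']
  simp only [hval]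
  congr! 3 with v
  · simp [e]
  · exact Equiv.sum_comp e fun j => r (v j)

theorem card_mul_integral_pi_div_sum (Q : Measure X) [IsProbabilityMeasure Q]
    (hr : Measurable r) (hrpos : ∀ x, 0 < r x) (i : ι) :
    Fintype.card ι * ∫ v : ι → X, r (v i) / ∑ j, r (v j) ∂(Measure.pi fun _ => Q) = 1 := by
  have hsum : ∑ k, ∫ v : ι → X, r (v k) / ∑ j, r (v j) ∂(Measure.pi fun _ => Q) = 1 := by
    rw [← integral_finsetSum _ fun k _ =>
      integrable_pi_div_sum _ hr (fun x => (hrpos x).le) k]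
    have hone (v : ι → X) : ∑ k, r (v k) / ∑ j, r (v j) = 1 := by
      rw [← Finset.sum_div]
      exact div_self (Finset.sum_pos (fun j _ => hrpos _) ⟨i, Finset.mem_univ i⟩).ne'
    simp [hone]
  simpa [fun k => integral_pi_div_sum_eq Q r k i] using hsum

end Exchangeable

/-- If `x, y_1, …, y_{m-1}` are drawn i.i.d. from a probability measure `Q` and
`r > 0`, then `E[m r(x) / (r(x) + Σ_i r(y_i))] ≤ 1`, where the expectation is
with respect to the product measure `Q^m`. -/
theorem stmt8 {X : Type*} [MeasurableSpace X] (Q : Measure X) [IsProbabilityMeasure Q]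
    (r : X → ℝ) (hr : Measurable r) (hrpos : ∀ x, 0 < r x) (m : ℕ) (hm : 2 ≤ m) :
    ∫ v : Fin m → X,
        (m : ℝ) * r (v ⟨0, by omega⟩) /
          (r (v ⟨0, by omega⟩)
            + ∑ i : Fin (m - 1), r (v ⟨(i : ℕ) + 1, by have := i.isLt; omega⟩))
      ∂(Measure.pi fun _ : Fin m => Q) ≤ 1 := by
  obtain ⟨n, rfl⟩ : ∃ n, m = n + 1 := ⟨m - 1, by omega⟩
  have h := card_mul_integral_pi_div_sum Q hr hrpos (0 : Fin (n + 1))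
  rw [← integral_const_mul] at h
  simp only [Fintype.card_fin, Fin.sum_univ_succ, ← mul_div_assoc] at h
  exact h.le
end

section
/- Let n ≥ 1 and m ≥ 2 be integers and let α be a real number with 0 < α ≤ m. For any strictly positive real numbers a_1, …, a_n and any nonnegative real numbers b_{j,k} for j ∈ {1,…,n}, k ∈ {1,…,m−1}, it holds that (1/n) Σ_{i=1}^n log( n m · a_i / ( α Σ_{j=1}^n a_j + ((m−α)/(m−1)) Σ_{j=1}^n Σ_{k=1}^{m−1} b_{j,k} ) ) ≤ log(m/α). -/
/-- The logarithms of the positive numbers `card ι * c * x i / D`, whose average is at most `1`,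
have nonpositive sum. -/
theorem sum_log_card_mul_div_nonpos {ι : Type*} [Fintype ι] {c D : ℝ} {x : ι → ℝ}
    (hc : 0 < c) (hD : 0 < D) (hx : ∀ i, 0 < x i) (h : c * ∑ i, x i ≤ D) :
    ∑ i, Real.log (Fintype.card ι * c * x i / D) ≤ 0 := by
  calc ∑ i, Real.log (Fintype.card ι * c * x i / D)
      ≤ ∑ i, (Fintype.card ι * c * x i / D - 1) := by
        refine Finset.sum_le_sum fun i _ => Real.log_le_sub_one_of_pos ?_
        have : 0 < (Fintype.card ι : ℝ) := by exact_mod_cast Fintype.card_pos_iff.mpr ⟨i⟩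
        have := hx i
        positivity
    _ = Fintype.card ι * ((c * ∑ i, x i) / D - 1) := by
        rw [Finset.sum_sub_distrib, ← Finset.sum_div, ← Finset.mul_sum]
        simp only [Finset.sum_const, Finset.card_univ, nsmul_eq_mul]
        ring
    _ ≤ 0 := mul_nonpos_of_nonneg_of_nonpos (Nat.cast_nonneg _)
        (sub_nonpos.mpr ((div_le_one hD).mpr h))

/-- Deterministic upper bound `log (m/α)` on any empirical evaluation of the
re-weighted multi-label CPC objective. -/
theorem stmt10 (n m : ℕ) (hn : 1 ≤ n) (hm : 2 ≤ m)
    (α : ℝ) (hα0 : 0 < α) (hαm : α ≤ (m : ℝ))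
    (a : Fin n → ℝ) (ha : ∀ i, 0 < a i)
    (b : Fin n → Fin (m - 1) → ℝ) (hb : ∀ j k, 0 ≤ b j k) :
    (1 / (n : ℝ)) * ∑ i : Fin n,
        Real.log ((n : ℝ) * (m : ℝ) * a i /
          (α * ∑ j : Fin n, a j
            + (((m : ℝ) - α) / ((m : ℝ) - 1)) * ∑ j : Fin n, ∑ k : Fin (m - 1), b j k))
      ≤ Real.log ((m : ℝ) / α) := by
  have hn0 : (0 : ℝ) < n := by exact_mod_cast hn
  have hm1 : (2 : ℝ) ≤ m := by exact_mod_cast hm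
  have hm0 : (0 : ℝ) < m := by linarith
  have hS : 0 < ∑ j, a j :=
    Finset.sum_pos (fun i _ => ha i) ⟨⟨0, hn⟩, Finset.mem_univ _⟩
  have hB : 0 ≤ (((m : ℝ) - α) / ((m : ℝ) - 1)) * ∑ j : Fin n, ∑ k : Fin (m - 1), b j k :=
    mul_nonneg (div_nonneg (by linarith) (by linarith))
      (Finset.sum_nonneg fun j _ => Finset.sum_nonneg fun k _ => hb j k)
  set D := α * ∑ j : Fin n, a j
    + (((m : ℝ) - α) / ((m : ℝ) - 1)) * ∑ j : Fin n, ∑ k : Fin (m - 1), b j k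
  have hSD : α * ∑ j, a j ≤ D := by linarith
  have hD : 0 < D := (mul_pos hα0 hS).trans_le hSD
  have hlog (i : Fin n) : Real.log ((n : ℝ) * m * a i / D) =
      Real.log (n * α * a i / D) + Real.log (m / α) := by
    have := ha i
    rw [← Real.log_mul (by positivity) (by positivity)]
    congr 1
    field_simp
  have key := sum_log_card_mul_div_nonpos hα0 hD ha hSD
  rw [Fintype.card_fin] at key
  simp only [hlog, Finset.sum_add_distrib, Finset.sum_const, Finset.card_univ, Fintype.card_fin,
    nsmul_eq_mul]
  rw [one_div, inv_mul_le_iff₀ hn0]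
  linarith
end

section
/- Let m ≥ 2 be an integer, let α > 0 be a real number, and let t be an integer with 1 ≤ t ≤ m − α. Let x > 0 and let y_1, …, y_{m−1} be strictly positive real numbers, extended cyclically by setting y_k := y_{k−(m−1)} for k > m−1. Then m·x / ( α·x + ((m−α)/(m−1)) Σ_{j=1}^{m−1} y_j ) ≤ (1/(m−1)) Σ_{j=1}^{m−1} ( m·x / ( α·x + Σ_{k=j}^{j+t−1} y_k ) ). -/
/-- The sum of a sequence of period `n` over any `n` consecutive indices is the same. -/
theorem sum_range_add_of_periodic {M : Type*} [AddCancelCommMonoid M] {n : ℕ} {f : ℕ → M}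
    (hf : Function.Periodic f n) (i : ℕ) :
    ∑ j ∈ Finset.range n, f (j + i) = ∑ j ∈ Finset.range n, f j := by
  induction i with
  | zero => rfl
  | succ i ih =>
    rw [← ih]
    have h := (Finset.sum_range_succ' (fun j => f (j + i)) n).symm.trans
      (Finset.sum_range_succ (fun j => f (j + i)) n)
    rw [show f (n + i) = f (0 + i) by rw [add_comm, hf, zero_add]] at h
    simpa [add_right_comm, add_assoc] using add_right_cancel h

/-- Each term of a sequence of period `n` is visited `t` times by the `n` cyclic windows of
length `t`. -/
theorem sum_range_sum_range_add_of_periodic {M : Type*} [AddCancelCommMonoid M] {n : ℕ}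
    {f : ℕ → M} (hf : Function.Periodic f n) (t : ℕ) :
    ∑ j ∈ Finset.range n, ∑ i ∈ Finset.range t, f (j + i) =
      t • ∑ j ∈ Finset.range n, f j := by
  rw [Finset.sum_comm]
  simp [sum_range_add_of_periodic hf]

/-- Harmonic-mean–arithmetic-mean bound on the re-weighted contrastive ratio via
cyclic window sums: `y` is strictly positive on `{1, …, m−1}` and is extended
cyclically with period `m − 1` beyond that range. -/
theorem stmt12 (m : ℕ) (hm : 2 ≤ m) (α : ℝ) (hα : 0 < α)
    (t : ℕ) (ht1 : 1 ≤ t) (ht : (t : ℝ) ≤ (m : ℝ) - α)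
    (x : ℝ) (hx : 0 < x) (y : ℕ → ℝ)
    (hy : ∀ k, 1 ≤ k → k ≤ m - 1 → 0 < y k)
    (hcyc : ∀ k, m - 1 < k → y k = y (k - (m - 1))) :
    (m : ℝ) * x /
        (α * x + (((m : ℝ) - α) / ((m : ℝ) - 1)) * ∑ j ∈ Finset.Icc 1 (m - 1), y j)
      ≤ (1 / ((m : ℝ) - 1)) * ∑ j ∈ Finset.Icc 1 (m - 1),
          ((m : ℝ) * x / (α * x + ∑ k ∈ Finset.Icc j (j + t - 1), y k)) := by
  obtain ⟨n, rfl⟩ : ∃ n, m = n + 1 := ⟨m - 1, by omega⟩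
  have hn : 0 < n := by omega
  have hn' : (0 : ℝ) < n := by exact_mod_cast hn
  simp only [Nat.add_sub_cancel] at hy hcyc ⊢
  set z : ℕ → ℝ := fun i => y (i + 1) with hz
  have hper : Function.Periodic z n := fun i => by
    simp only [hz]
    rw [hcyc (i + n + 1) (by omega)]
    congr 1
    omega
  have hpos : ∀ i, 0 < z i := fun i => by
    rw [← hper.map_mod_nat]
    have := Nat.mod_lt i hn
    exact hy _ (by omega) (by omega)
  have hIcc : ∀ f : ℕ → ℝ, ∑ j ∈ Finset.Icc 1 n, f j = ∑ j ∈ Finset.range n, f (j + 1) := by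
    intro f
    rw [Finset.range_eq_Ico, Finset.sum_Ico_add' f 0 n 1]
    rfl
  have hwin : ∀ j, ∑ k ∈ Finset.Icc (j + 1) (j + 1 + t - 1), y k =
      ∑ i ∈ Finset.range t, z (j + i) := by
    intro j
    rw [show Finset.Icc (j + 1) (j + 1 + t - 1) = Finset.Ico (j + 1) (j + 1 + t) by
      ext k; simp only [Finset.mem_Icc, Finset.mem_Ico]; omega, Finset.sum_Ico_eq_sum_range]
    simp [hz, add_right_comm]
  rw [hIcc, hIcc]
  simp only [hwin]
  push_cast at ht ⊢
  rw [add_sub_cancel_right]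
  set S := ∑ j ∈ Finset.range n, y (j + 1) with hS
  have hS0 : 0 < S := Finset.sum_pos (fun i _ => hpos i) (by simpa using hn.ne')
  set d : ℕ → ℝ := fun j => α * x + ∑ i ∈ Finset.range t, z (j + i) with hd
  have hd0 : ∀ j, 0 < d j := fun j =>
    add_pos_of_pos_of_nonneg (by positivity) (Finset.sum_nonneg fun i _ => (hpos _).le)
  have hsum : ∑ j ∈ Finset.range n, d j = n * (α * x) + t * S := by
    simp only [hd, Finset.sum_add_distrib, sum_range_sum_range_add_of_periodic hper]
    simp [hS, hz]
  have hHM : (n : ℝ) ^ 2 / (n * (α * x) + t * S) ≤ ∑ j ∈ Finset.range n, 1 / d j := by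
    simpa [hsum] using
      Finset.sq_sum_div_le_sum_sq_div (Finset.range n) (fun _ => (1 : ℝ)) fun j _ => hd0 j
  have hfac : ∑ j ∈ Finset.range n, (n + 1 : ℝ) * x / d j =
      (n + 1) * x * ∑ j ∈ Finset.range n, 1 / d j := by
    rw [Finset.mul_sum]
    simp [div_eq_mul_inv]
  calc ((n : ℝ) + 1) * x / (α * x + (n + 1 - α) / n * S)
      ≤ (n + 1) * x / (α * x + t / n * S) := by gcongr
    _ = 1 / n * ((n + 1) * x * ((n : ℝ) ^ 2 / (n * (α * x) + t * S))) := by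
      field_simp
    _ ≤ 1 / n * ((n + 1) * x * ∑ j ∈ Finset.range n, 1 / d j) := by gcongr
    _ = _ := by rw [← hfac]
end
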